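/- Let (G_n)_{n≥1} be a recursive family of graphs as in Definition 1 (see context). If κ₃(G_1) = r − 1 and, for every n ≥ 2, any two vertices lying in different copies of G_{n−1} inside G_n have at most one common outside neighbour, then κ₃(G_n) = r + 2n − 3 for every n ≥ 1. -/

import Mathlib

/-- A graph `G` is `k`-connected if it has more than `k` vertices and removing any set of
fewer than `k` vertices leaves a connected graph (equivalently, `κ(G) ≥ k`). -/
def IsKConnected {V : Type*} [Fintype V] (k : ℕ) (G : SimpleGraph V) : Prop :=
  k < Fintype.card V ∧ ∀ D : Set V, D.ncard < k → (G.induce Dᶜ).Connected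

/-- There exist `r` internally disjoint trees connecting `S` in `G`: `r` pairwise
edge-disjoint trees `T₁, …, T_r` of `G`, each containing `S`, with
`V(T_a) ∩ V(T_b) = S` for all `a ≠ b`. -/
def ConnectsSet {V : Type*} (G : SimpleGraph V) (S : Set V) (r : ℕ) : Prop :=
  ∃ T : Fin r → G.Subgraph,
    (∀ a, (T a).coe.IsTree) ∧
    (∀ a, S ⊆ (T a).verts) ∧
    (∀ a b, a ≠ b → (T a).verts ∩ (T b).verts = S) ∧
    (∀ a b, a ≠ b → Disjoint (T a).edgeSet (T b).edgeSet)

/-- `κ_G(S)`: the maximum number of internally disjoint trees connecting `S` in `G`. -/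
noncomputable def treeConn {V : Type*} (G : SimpleGraph V) (S : Set V) : ℕ :=
  sSup {r | ConnectsSet G S r}

/-- The generalized 3-connectivity `κ₃(G) = min {κ_G(S) : S ⊆ V(G), |S| = 3}`. -/
noncomputable def kappa3 {V : Type*} (G : SimpleGraph V) : ℕ :=
  sInf {k | ∃ S : Set V, S.ncard = 3 ∧ treeConn G S = k}

/-- `ReachIn G U a b`: there is a walk in `G` from `a` to `b` all of whose vertices lie in `U`
(or `a = b`). -/
def ReachIn {V : Type*} (G : SimpleGraph V) (U : Set V) (a b : V) : Prop :=
  Relation.ReflTransGen (fun u v => G.Adj u v ∧ u ∈ U ∧ v ∈ U) a b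

/-- `ConnOn G P`: any two vertices of `P` are joined inside `P` (so `∅` is allowed). -/
def ConnOn {V : Type*} (G : SimpleGraph V) (P : Set V) : Prop :=
  ∀ a ∈ P, ∀ b ∈ P, ReachIn G P a b

section Basics

variable {V : Type*} {G G' : SimpleGraph V} {U U' P Q : Set V} {a b c : V}

theorem ReachIn.refl (G : SimpleGraph V) (U : Set V) (a : V) : ReachIn G U a a :=
  Relation.ReflTransGen.refl

theorem ReachIn.trans (h : ReachIn G U a b) (h' : ReachIn G U b c) : ReachIn G U a c :=
  Relation.ReflTransGen.trans h h'

theorem ReachIn.single (h : G.Adj a b) (ha : a ∈ U) (hb : b ∈ U) : ReachIn G U a b :=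
  Relation.ReflTransGen.single ⟨h, ha, hb⟩

theorem ReachIn.tail (h : ReachIn G U a b) (hbc : G.Adj b c) (hb : b ∈ U) (hc : c ∈ U) :
    ReachIn G U a c :=
  Relation.ReflTransGen.tail h ⟨hbc, hb, hc⟩

theorem ReachIn.symm (h : ReachIn G U a b) : ReachIn G U b a := by
  induction h with
  | refl => exact ReachIn.refl _ _ _
  | tail _ hbc ih => exact (ReachIn.single hbc.1.symm hbc.2.2 hbc.2.1).trans ih

theorem ReachIn.mono' (h : ReachIn G U a b) (hU : U ⊆ U')
    (hG : ∀ u ∈ U, ∀ v ∈ U, G.Adj u v → G'.Adj u v) : ReachIn G' U' a b := by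
  induction h with
  | refl => exact ReachIn.refl _ _ _
  | tail _ h ih => exact ih.tail (hG _ h.2.1 _ h.2.2 h.1) (hU h.2.1) (hU h.2.2)

theorem ReachIn.mono (h : ReachIn G U a b) (hU : U ⊆ U') : ReachIn G U' a b :=
  h.mono' hU fun _ _ _ _ h => h

theorem ReachIn.mem_of_closed {R : Set V} (h : ReachIn G U a b) (ha : a ∈ R)
    (hR : ∀ u ∈ R, ∀ v, u ∈ U → v ∈ U → G.Adj u v → v ∈ R) : b ∈ R := by
  induction h with
  | refl => exact ha
  | tail _ hbc ih => exact hR _ ih _ hbc.2.1 hbc.2.2 hbc.1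

theorem ReachIn.mem (h : ReachIn G U a b) (ha : a ∈ U) : b ∈ U :=
  h.mem_of_closed ha fun _ _ _ _ hv _ => hv

theorem ConnOn.empty (G : SimpleGraph V) : ConnOn G ∅ := fun _ h => h.elim

theorem ConnOn.singleton (G : SimpleGraph V) (a : V) : ConnOn G {a} := by
  rintro x rfl y rfl
  exact ReachIn.refl _ _ _

theorem ConnOn.mono (h : ConnOn G P) (hG : ∀ u ∈ P, ∀ v ∈ P, G.Adj u v → G'.Adj u v) :
    ConnOn G' P :=
  fun a ha b hb => (h a ha b hb).mono' subset_rfl hG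

theorem ConnOn.of_root {r : V} (h : ∀ a ∈ P, ReachIn G P r a) : ConnOn G P :=
  fun a ha b hb => (h a ha).symm.trans (h b hb)

theorem ConnOn.union_of_adj (hP : ConnOn G P) (hQ : ConnOn G Q) {u v : V} (hu : u ∈ P)
    (hv : v ∈ Q) (huv : G.Adj u v) : ConnOn G (P ∪ Q) := by
  refine ConnOn.of_root (r := u) ?_
  rintro a (ha | ha)
  · exact (hP u hu a ha).mono Set.subset_union_left
  · exact (ReachIn.single huv (Or.inl hu) (Or.inr hv)).trans
      ((hQ v hv a ha).mono Set.subset_union_right)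

theorem ConnOn.union_of_mem (hP : ConnOn G P) (hQ : ConnOn G Q) {u : V} (hu : u ∈ P)
    (hv : u ∈ Q) : ConnOn G (P ∪ Q) := by
  refine ConnOn.of_root (r := u) ?_
  rintro a (ha | ha)
  · exact (hP u hu a ha).mono Set.subset_union_left
  · exact (hQ u hv a ha).mono Set.subset_union_right

theorem ConnOn.insert_of_adj (hP : ConnOn G P) {u v : V} (hu : u ∈ P) (huv : G.Adj u v) :
    ConnOn G (insert v P) := by
  rw [Set.insert_eq]
  exact (ConnOn.singleton G v).union_of_adj hP rfl hu huv.symm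

/-- The set reached from `a` inside `U` is connected. -/
theorem ConnOn.reachSet (G : SimpleGraph V) (U : Set V) (a : V) :
    ConnOn G {b | ReachIn G U a b} := by
  refine ConnOn.of_root (r := a) fun b hb => ?_
  induction (show ReachIn G U a b from hb) with
  | refl => exact ReachIn.refl _ _ _
  | tail h1 h2 ih =>
    exact (ih h1).tail h2.1 h1 (Relation.ReflTransGen.tail h1 h2)

theorem ConnOn.biUnion_of_mem {ι : Type*} {P : ι → Set V} (r : V) (hr : ∀ i, r ∈ P i)
    (hP : ∀ i, ConnOn G (P i)) : ConnOn G (⋃ i, P i) := by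
  refine ConnOn.of_root (r := r) fun a ha => ?_
  obtain ⟨i, hi⟩ := Set.mem_iUnion.1 ha
  exact (hP i r (hr i) a hi).mono (Set.subset_iUnion P i)

/-- Cutting a connected set down at its first visit to `T`. -/
theorem ConnOn.trim {A T : Set V} (hP : ConnOn G P) (ha : a ∈ P) (haA : a ∈ A)
    (hT : (P ∩ T).Nonempty) :
    ∃ (R : Set V) (t : V), t ∈ T ∧ t ∈ P ∧ R ⊆ P \ T ∧
      ((R = ∅ ∧ t ∈ A) ∨ (ConnOn G R ∧ (R ∩ A).Nonempty ∧ ∃ u ∈ R, G.Adj u t)) := by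
  by_cases haT : a ∈ T
  · exact ⟨∅, a, haT, ha, Set.empty_subset _, Or.inl ⟨rfl, haA⟩⟩
  obtain ⟨t, htP, htT⟩ := hT
  set R : Set V := {b | ReachIn G (P \ T) a b} with hR
  have hRsub : R ⊆ P \ T := fun b hb => ReachIn.mem hb ⟨ha, haT⟩
  have htR : t ∉ R := fun h => (hRsub h).2 htT
  obtain ⟨u, huR, v, hvR, huv, hvP⟩ :
      ∃ u ∈ R, ∃ v, v ∉ R ∧ G.Adj u v ∧ v ∈ P := by
    by_contra! hcon
    refine htR ((hP a ha t htP).mem_of_closed (ReachIn.refl _ _ _) fun u hu v _ hv huv => ?_)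
    by_contra hvR
    exact hcon u hu v hvR huv hv
  have hvT : v ∈ T := by
    by_contra hvT
    exact hvR (ReachIn.tail huR huv (hRsub huR) ⟨hvP, hvT⟩)
  exact ⟨R, v, hvT, hvP, hRsub, Or.inr ⟨ConnOn.reachSet _ _ _, ⟨a, ReachIn.refl _ _ _, haA⟩,
    u, huR, huv⟩⟩

end Basics

/-- Every walk of `G` from `A` to `B` meets `C`. -/
def Separates {V : Type*} (G : SimpleGraph V) (A B C : Set V) : Prop :=
  ∀ a ∈ A, ∀ b ∈ B, a ∉ C → ¬ ReachIn G Cᶜ a b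

section Menger

variable {V : Type*} {G G' : SimpleGraph V} {A B C W : Set V} {x y : V}

theorem Separates.symm (h : Separates G A B C) : Separates G B A C := fun b hb a ha hbC hr =>
  h a ha b hb (fun haC => (ReachIn.mem hr hbC) haC) hr.symm

theorem separates_of_separates_insert (hW : Separates G' A B W)
    (hG : ∀ u v, G.Adj u v → G'.Adj u v ∨ (u = x ∧ v = y) ∨ (u = y ∧ v = x))
    (hy : ∀ a ∈ A, a ∉ W → ¬ ReachIn G' Wᶜ a y)
    (hC : Separates G' A (insert x W) C) : Separates G A B C := by
  intro a ha b hb haC hr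
  have haW : a ∉ insert x W := fun h => hC a ha a h haC (ReachIn.refl _ _ _)
  let R : Set V := {v | v ∉ C ∧ v ∉ insert x W ∧ ReachIn G' Cᶜ a v ∧ ReachIn G' Wᶜ a v}
  have hbR : b ∈ R := by
    refine hr.mem_of_closed (R := R) ⟨haC, haW, ReachIn.refl _ _ _, ReachIn.refl _ _ _⟩ ?_
    rintro u ⟨huC, huW, hu1, hu2⟩ v _ hvC huv
    have huW' : u ∉ W := fun h => huW (Or.inr h)
    rcases hG u v huv with h | ⟨rfl, rfl⟩ | ⟨rfl, rfl⟩
    · have h1 : ReachIn G' Cᶜ a v := hu1.tail h huC hvC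
      have hvW : v ∉ insert x W := fun hv => hC a ha v hv haC h1
      exact ⟨hvC, hvW, h1, hu2.tail h huW' fun hv => hvW (Or.inr hv)⟩
    · exact (huW (Or.inl rfl)).elim
    · exact (hy a ha (fun h => haW (Or.inr h)) hu2).elim
  exact hW a ha b hb (fun h => haW (Or.inr h)) hbR.2.2.2

theorem ConnOn.exists_trimmed {P A T : Set V} (hP : ConnOn G P) (hA : (P ∩ A).Nonempty)
    (hT : (P ∩ T).Nonempty) :
    ∃ (P' : Set V) (t : V), P' ⊆ P ∧ ConnOn G P' ∧ t ∈ T ∧ t ∈ P' ∧ (∀ v ∈ P', v ∈ T → v = t) ∧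
      (P' ∩ A).Nonempty ∧ ∀ v ∈ P', v ∉ T → ∃ a ∈ A, a ∉ T ∧ ReachIn G Tᶜ a v := by
  obtain ⟨a, haP, haA⟩ := hA
  obtain ⟨R, t, htT, htP, hRP, h⟩ := hP.trim haP haA hT
  refine ⟨insert t R, t, ?_, ?_, htT, Or.inl rfl, ?_, ?_, ?_⟩
  · exact Set.insert_subset htP (hRP.trans Set.sdiff_subset)
  · rcases h with ⟨rfl, _⟩ | ⟨hR, _, u, hu, hut⟩
    · simpa using ConnOn.singleton G t
    · exact hR.insert_of_adj hu hut
  · rintro v (rfl | hv) hvT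
    · rfl
    · exact ((hRP hv).2 hvT).elim
  · rcases h with ⟨_, ht⟩ | ⟨_, ⟨w, hw, hwA⟩, _⟩
    · exact ⟨t, Or.inl rfl, ht⟩
    · exact ⟨w, Or.inr hw, hwA⟩
  · rintro v (rfl | hv) hvT
    · exact (hvT htT).elim
    · rcases h with ⟨rfl, ht⟩ | ⟨hR, ⟨w, hw, hwA⟩, _⟩
      · exact hv.elim
      · exact ⟨w, hwA, (hRP hw).2, (hR w hw v hv).mono fun z hz => (hRP hz).2⟩

theorem surj_of_inj_ncard [Finite V] {k : ℕ} {T : Set V} (hT : T.ncard ≤ k) (t : Fin k → V)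
    (ht : ∀ i, t i ∈ T) (hinj : Function.Injective t) : ∀ v ∈ T, ∃ i, t i = v := by
  have h : Set.range t = T := by
    refine Set.eq_of_subset_of_ncard_le (Set.range_subset_iff.2 ht) ?_ (Set.toFinite _)
    rw [← Set.image_univ, Set.ncard_image_of_injective _ hinj]
    simpa using hT
  intro v hv
  rw [← h] at hv
  exact hv

/-- Gluing the two halves in the inductive step of Menger's theorem. -/
theorem exists_disjoint_conn_of_halves [Finite V] {k : ℕ} (hG : ∀ u v, G'.Adj u v → G.Adj u v)
    (hxy : G.Adj x y) (hW : Separates G' A B W) (hWk : W.ncard + 1 ≤ k)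
    (hyW : y ∉ W)
    (hyA : ∀ a ∈ A, a ∉ W → ¬ ReachIn G' Wᶜ a y)
    (hxB : ∀ b ∈ B, b ∉ W → ¬ ReachIn G' Wᶜ b x)
    (P Q : Fin k → Set V) (hP : ∀ i j, i ≠ j → Disjoint (P i) (P j))
    (hQ : ∀ i j, i ≠ j → Disjoint (Q i) (Q j))
    (hP' : ∀ i, ConnOn G' (P i) ∧ (P i ∩ A).Nonempty ∧ (P i ∩ insert x W).Nonempty)
    (hQ' : ∀ i, ConnOn G' (Q i) ∧ (Q i ∩ B).Nonempty ∧ (Q i ∩ insert y W).Nonempty) :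
    ∃ P : Fin k → Set V, (∀ i j, i ≠ j → Disjoint (P i) (P j)) ∧
      ∀ i, ConnOn G (P i) ∧ (P i ∩ A).Nonempty ∧ (P i ∩ B).Nonempty := by
  classical
  choose P1 t hP1 hP1c htT htP hPt hPA hPR using
    fun i => (hP' i).1.exists_trimmed (hP' i).2.1 (hP' i).2.2
  choose Q1 q hQ1 hQ1c hqT hqQ hQq hQB hQR using
    fun i => (hQ' i).1.exists_trimmed (hQ' i).2.1 (hQ' i).2.2
  have hPd : ∀ i j v, v ∈ P1 i → v ∈ P1 j → i = j := by
    intro i j v hi hj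
    by_contra hne
    exact Set.disjoint_left.1 (hP i j hne) (hP1 i hi) (hP1 j hj)
  have hQd : ∀ i j v, v ∈ Q1 i → v ∈ Q1 j → i = j := by
    intro i j v hi hj
    by_contra hne
    exact Set.disjoint_left.1 (hQ i j hne) (hQ1 i hi) (hQ1 j hj)
  have hinter : ∀ i j v, v ∈ P1 i → v ∈ Q1 j → v ∈ W := by
    intro i j v hvP hvQ
    by_contra hvW
    have hA : v ∉ insert x W → ∃ a ∈ A, a ∉ W ∧ ReachIn G' Wᶜ a v := by
      intro h
      obtain ⟨a, ha, haT, har⟩ := hPR i v hvP h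
      exact ⟨a, ha, fun h => haT (Or.inr h), har.mono fun z hz h => hz (Or.inr h)⟩
    have hB : v ∉ insert y W → ∃ a ∈ B, a ∉ W ∧ ReachIn G' Wᶜ a v := by
      intro h
      obtain ⟨a, ha, haT, har⟩ := hQR j v hvQ h
      exact ⟨a, ha, fun h => haT (Or.inr h), har.mono fun z hz h => hz (Or.inr h)⟩
    by_cases hvx : v = x
    · obtain ⟨b, hb, hbW, hr⟩ := hB (by
        rintro (h | h)
        · exact hxy.ne (hvx.symm.trans h)
        · exact hvW h)
      exact hxB b hb hbW (hvx ▸ hr)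
    obtain ⟨a, ha, haW, har⟩ := hA (by
      rintro (h | h)
      · exact hvx h
      · exact hvW h)
    by_cases hvy : v = y
    · exact hyA a ha haW (hvy ▸ har)
    obtain ⟨b, hb, hbW, hr⟩ := hB (by
      rintro (h | h)
      · exact hvy h
      · exact hvW h)
    exact hW a ha b hb haW (har.trans hr.symm)
  have hqinj : Function.Injective q := fun i j h => hQd i j (q i) (hqQ i) (h ▸ hqQ j)
  have hqs := surj_of_inj_ncard ((Set.ncard_insert_le y W).trans hWk) q hqT hqinj
  have hθ : ∀ i, (if t i = x then y else t i) ∈ insert y W := by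
    intro i
    split_ifs with h
    · exact Or.inl rfl
    · exact Or.inr ((htT i).resolve_left h)
  choose σ hσ using fun i => hqs _ (hθ i)
  have hσinj : ∀ i j, σ i = σ j → i = j := by
    intro i j h
    have h1 : (if t i = x then y else t i) = if t j = x then y else t j := by
      rw [← hσ i, ← hσ j, h]
    have key : t i = t j := by
      split_ifs at h1 with h2 h3 h3
      · rw [h2, h3]
      · exact (hyW (h1 ▸ (htT j).resolve_left h3)).elim
      · exact (hyW (h1 ▸ (htT i).resolve_left h2)).elim
      · exact h1
    exact hPd i j (t i) (htP i) (key ▸ htP j)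
  have hcross : ∀ i j v, v ∈ P1 i → v ∈ Q1 (σ j) → i = j := by
    intro i j v hi hj
    have hvW := hinter i _ v hi hj
    have h1 : v = t i := hPt i v hi (Or.inr hvW)
    have h2 : v = q (σ j) := hQq _ v hj (Or.inr hvW)
    rw [hσ j] at h2
    split_ifs at h2 with h3
    · exact (hyW (h2 ▸ hvW)).elim
    · exact hPd i j v hi (h2 ▸ htP j)
  refine ⟨fun i => P1 i ∪ Q1 (σ i), ?_, fun i => ⟨?_, ?_, ?_⟩⟩
  · intro i j hij
    rw [Set.disjoint_left]
    rintro v (hv | hv) (hv' | hv')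
    · exact hij (hPd i j v hv hv')
    · exact hij (hcross i j v hv hv')
    · exact hij (hcross j i v hv' hv).symm
    · exact hij (hσinj i j (hQd _ _ v hv hv'))
  · have h1 := (hP1c i).mono (fun u _ v _ h => hG u v h)
    have h2 := (hQ1c (σ i)).mono (fun u _ v _ h => hG u v h)
    have h3 := hσ i
    split_ifs at h3 with h
    · exact h1.union_of_adj h2 (h ▸ htP i) (h3 ▸ hqQ (σ i)) hxy
    · exact h1.union_of_mem h2 (htP i) (h3 ▸ hqQ (σ i))
  · obtain ⟨a, ha, haA⟩ := hPA i
    exact ⟨a, Or.inl ha, haA⟩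
  · obtain ⟨a, ha, haA⟩ := hQB (σ i)
    exact ⟨a, Or.inr ha, haA⟩

theorem exists_subset_of_le_ncard [Finite V] {k : ℕ} {T : Set V} (h : k ≤ T.ncard) :
    ∃ f : Fin k → V, Function.Injective f ∧ ∀ i, f i ∈ T := by
  have : k ≤ Nat.card T := by rwa [Nat.card_coe_set_eq]
  have e := Finite.equivFin T
  refine ⟨fun i => (e.symm (Fin.castLE this i) : V), ?_, fun i => (e.symm _).2⟩
  intro i j hij
  exact Fin.castLE_injective _ (e.symm.injective (Subtype.ext hij))

/-- Menger's theorem for two sets, with connected vertex sets in place of paths. -/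
theorem exists_disjoint_conn_of_separates [Finite V] (G : SimpleGraph V) (A B : Set V) (k : ℕ)
    (h : ∀ C, Separates G A B C → k ≤ C.ncard) :
    ∃ P : Fin k → Set V, (∀ i j, i ≠ j → Disjoint (P i) (P j)) ∧
      ∀ i, ConnOn G (P i) ∧ (P i ∩ A).Nonempty ∧ (P i ∩ B).Nonempty := by
  induction hn : G.edgeSet.ncard using Nat.strong_induction_on generalizing G A B with
  | _ n ih =>
  by_cases hE : ∃ x y, G.Adj x y
  swap
  · push Not at hE
    have hsep : Separates G A B (A ∩ B) := by
      intro a ha b hb hab hr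
      have : b = a := hr.mem_of_closed (R := {a}) rfl fun u _ v _ _ huv => (hE _ _ huv).elim
      exact hab ⟨ha, this ▸ hb⟩
    obtain ⟨f, hf, hfm⟩ := exists_subset_of_le_ncard (h _ hsep)
    refine ⟨fun i => {f i}, fun i j hij => ?_, fun i => ⟨ConnOn.singleton _ _, ?_, ?_⟩⟩
    · simpa using fun h => hij (hf h)
    · exact ⟨f i, rfl, (hfm i).1⟩
    · exact ⟨f i, rfl, (hfm i).2⟩
  obtain ⟨x0, y0, hxy0⟩ := hE
  set G' := G.deleteEdges {s(x0, y0)} with hG'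
  have hadj : ∀ u v, G'.Adj u v → G.Adj u v := fun u v h => (SimpleGraph.deleteEdges_adj.1 h).1
  have hadj' : ∀ u v, G.Adj u v → ¬ G'.Adj u v → s(u, v) = s(x0, y0) := by
    intro u v huv hn
    by_contra hne
    exact hn (SimpleGraph.deleteEdges_adj.2 ⟨huv, hne⟩)
  have hlt : G'.edgeSet.ncard < n := by
    rw [← hn]
    refine Set.ncard_lt_ncard ?_ (Set.toFinite _)
    rw [hG', SimpleGraph.edgeSet_deleteEdges]
    refine ⟨Set.sdiff_subset, fun hs => ?_⟩
    exact (hs (show s(x0, y0) ∈ G.edgeSet from hxy0)).2 rfl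
  by_cases hall : ∀ C, Separates G' A B C → k ≤ C.ncard
  · obtain ⟨P, hP, hP'⟩ := ih _ hlt G' A B hall rfl
    exact ⟨P, hP, fun i => ⟨(hP' i).1.mono fun u _ v _ => hadj u v, (hP' i).2⟩⟩
  push Not at hall
  obtain ⟨W, hW, hWk⟩ := hall
  have hnot : ¬ Separates G A B W := fun hs => (h W hs).not_gt hWk
  simp only [Separates, not_forall, not_not] at hnot
  obtain ⟨a0, ha0, b0, hb0, ha0W, hr0⟩ := hnot
  have hb0W : b0 ∉ W := ReachIn.mem hr0 ha0W
  have key : ∀ (A' B' : Set V), Separates G' A' B' W → ∀ a ∈ A', ∀ b ∈ B', a ∉ W →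
      ReachIn G Wᶜ a b → ∃ u v, (∃ a' ∈ A', a' ∉ W ∧ ReachIn G' Wᶜ a' u) ∧ u ∉ W ∧ v ∉ W ∧
        G.Adj u v ∧ s(u, v) = s(x0, y0) := by
    intro A' B' hs a ha b hb haW hr
    by_contra! hcon
    let R : Set V := {v | ∃ a' ∈ A', a' ∉ W ∧ ReachIn G' Wᶜ a' v}
    have : b ∈ R := by
      refine hr.mem_of_closed (R := R) ⟨a, ha, haW, ReachIn.refl _ _ _⟩ ?_
      rintro u ⟨a', ha', ha'W, hr'⟩ v huW hvW huv
      by_cases h : G'.Adj u v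
      · exact ⟨a', ha', ha'W, hr'.tail h huW hvW⟩
      · exact (hcon u v ⟨a', ha', ha'W, hr'⟩ huW hvW huv (hadj' u v huv h)).elim
    obtain ⟨a', ha', ha'W, hr'⟩ := this
    exact hs a' ha' b hb ha'W hr'
  obtain ⟨x, y, ⟨a, ha, haW, hax⟩, hxW, hyW, hxy, hexy⟩ := key A B hW a0 ha0 b0 hb0 ha0W hr0
  obtain ⟨y', x', ⟨b, hb, hbW, hby⟩, -, -, -, heyx⟩ :=
    key B A hW.symm b0 hb0 a0 ha0 hb0W hr0.symm
  have hy' : y' = y := by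
    have : s(y', x') = s(x, y) := heyx.trans hexy.symm
    rcases Sym2.eq_iff.1 this with ⟨h1, -⟩ | ⟨h1, -⟩
    · exact (hW a ha b hb haW (hax.trans (h1 ▸ hby.symm))).elim
    · exact h1
  subst hy'
  have hyA : ∀ a ∈ A, a ∉ W → ¬ ReachIn G' Wᶜ a y' := fun a ha haW hr =>
    hW a ha b hb haW (hr.trans hby.symm)
  have hxB : ∀ b ∈ B, b ∉ W → ¬ ReachIn G' Wᶜ b x := fun b hb hbW hr =>
    hW a ha b hb haW (hax.trans hr.symm)
  have hG1 : ∀ u v, G.Adj u v → G'.Adj u v ∨ (u = x ∧ v = y') ∨ (u = y' ∧ v = x) := by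
    intro u v huv
    by_cases h : G'.Adj u v
    · exact Or.inl h
    · have h1 : s(u, v) = s(x, y') := (hadj' u v huv h).trans hexy.symm
      exact Or.inr (by simpa [Sym2.eq_iff] using h1)
  have hG2 : ∀ u v, G.Adj u v → G'.Adj u v ∨ (u = y' ∧ v = x) ∨ (u = x ∧ v = y') :=
    fun u v huv => (hG1 u v huv).imp_right Or.symm
  obtain ⟨P, hP, hP'⟩ := ih _ hlt G' A (insert x W)
    (fun C hC => h C (separates_of_separates_insert hW hG1 hyA hC)) rfl
  obtain ⟨Q, hQ, hQ'⟩ := ih _ hlt G' B (insert y' W)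
    (fun C hC => h C (separates_of_separates_insert hW.symm hG2 hxB hC).symm) rfl
  exact exists_disjoint_conn_of_halves hadj hxy hW hWk hyW hyA hxB P Q hP hQ hP' hQ'

end Menger

section Fan

variable {V : Type*}

/-- The graph `G` on `U \ {z}` with one extra vertex for each target set `N l`. -/
def fanGraph {Λ : Type*} (G : SimpleGraph V) (U : Set V) (z : V) (N : Λ → Set V) :
    SimpleGraph (V ⊕ Λ) where
  Adj
    | Sum.inl u, Sum.inl v => G.Adj u v ∧ u ∈ U \ {z} ∧ v ∈ U \ {z}
    | Sum.inl u, Sum.inr l => u ∈ U \ {z} ∧ u ∈ N l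
    | Sum.inr l, Sum.inl u => u ∈ U \ {z} ∧ u ∈ N l
    | Sum.inr _, Sum.inr _ => False
  symm := ⟨by
    rintro (u | u) (v | v) h
    · exact ⟨h.1.symm, h.2.2, h.2.1⟩
    · exact h
    · exact h
    · exact h⟩
  loopless := ⟨by
    rintro (u | u) h
    · exact G.loopless.irrefl _ h.1
    · exact h⟩

theorem connOn_preimage_inl {Λ : Type*} {G : SimpleGraph V} {U : Set V} {z : V} {N : Λ → Set V}
    {R : Set (V ⊕ Λ)} (hR : ConnOn (fanGraph G U z N) R) (hl : ∀ w ∈ R, ∃ v, w = Sum.inl v) :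
    ConnOn G (Sum.inl ⁻¹' R) := by
  intro a ha b hb
  have key : ∀ w, ReachIn (fanGraph G U z N) R (Sum.inl a) w →
      ∃ v, w = Sum.inl v ∧ ReachIn G (Sum.inl ⁻¹' R) a v := by
    intro w hw
    induction hw with
    | refl => exact ⟨a, rfl, ReachIn.refl _ _ _⟩
    | @tail p q _ hpq ih =>
      obtain ⟨v, rfl, hv⟩ := ih
      obtain ⟨v', rfl⟩ := hl _ hpq.2.2
      exact ⟨v', rfl, hv.tail hpq.1.1 hpq.2.1 hpq.2.2⟩
  obtain ⟨v, hv, hr⟩ := key _ (hR _ ha _ hb)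
  rwa [Sum.inl_injective hv]

/-- Fan version of Menger's theorem: disjoint connected sets from `z` to prescribed targets. -/
theorem exists_fan [Finite V] {Λ : Type*} [Finite Λ] (G : SimpleGraph V) (U : Set V) (z : V)
    (N : Λ → Set V)
    (h : ∀ C ⊆ U \ {z}, ∀ J : Set Λ, C.ncard + J.ncard < Nat.card Λ →
      ∃ l, l ∉ J ∧ ∃ v ∈ N l, ReachIn G (U \ C) z v) :
    ∃ R : Λ → Set V, (∀ i j, i ≠ j → Disjoint (R i) (R j)) ∧ ∀ l, R l ⊆ U \ {z} ∧
      ((R l = ∅ ∧ z ∈ N l) ∨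
        (ConnOn G (R l) ∧ (∃ u ∈ R l, G.Adj z u) ∧ (R l ∩ N l).Nonempty)) := by
  classical
  set X := fanGraph G U z N with hX
  let A : Set (V ⊕ Λ) := {w | (∃ v, w = Sum.inl v ∧ v ∈ U \ {z} ∧ G.Adj z v) ∨
    ∃ l, w = Sum.inr l ∧ z ∈ N l}
  let B : Set (V ⊕ Λ) := Set.range Sum.inr
  obtain ⟨P, hPd, hP⟩ := exists_disjoint_conn_of_separates X A B (Nat.card Λ) (by
    intro C' hC'
    by_contra! hlt
    set C : Set V := Sum.inl ⁻¹' C' ∩ (U \ {z})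
    set J : Set Λ := Sum.inr ⁻¹' C'
    have hcard : C.ncard + J.ncard ≤ C'.ncard := by
      rw [← Set.ncard_image_of_injective C Sum.inl_injective,
        ← Set.ncard_image_of_injective J (Sum.inr_injective (α := V)),
        ← Set.ncard_union_eq _ (Set.toFinite _) (Set.toFinite _)]
      · refine Set.ncard_le_ncard ?_ (Set.toFinite _)
        rintro w (⟨v, hv, rfl⟩ | ⟨v, hv, rfl⟩)
        · exact hv.1
        · exact hv
      · rw [Set.disjoint_left]
        rintro w ⟨v, hv, rfl⟩ ⟨v', hv', h⟩
        cases h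
    obtain ⟨l, hlJ, v, hv, hr⟩ := h C Set.inter_subset_right J (by omega)
    have key : ∀ v, ReachIn G (U \ C) z v →
        v = z ∨ (v ∈ U \ {z} ∧ ∃ a ∈ A, a ∉ C' ∧ ReachIn X C'ᶜ a (Sum.inl v)) := by
      intro v hv
      induction hv with
      | refl => exact Or.inl rfl
      | @tail b c _ hbc ih =>
        by_cases hc : c = z
        · exact Or.inl hc
        have hcU : c ∈ U \ {z} := ⟨hbc.2.2.1, hc⟩
        have hcC : Sum.inl c ∉ C' := fun hc' => hbc.2.2.2 ⟨hc', hcU⟩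
        refine Or.inr ⟨hcU, ?_⟩
        rcases ih with rfl | ⟨hbU, a, ha, haC, har⟩
        · exact ⟨Sum.inl c, Or.inl ⟨c, rfl, hcU, hbc.1⟩, hcC, ReachIn.refl _ _ _⟩
        · exact ⟨a, ha, haC, har.tail (b := Sum.inl b) (c := Sum.inl c) ⟨hbc.1, hbU, hcU⟩
            (har.mem haC) hcC⟩
    rcases key v hr with rfl | ⟨hvU, a, ha, haC, har⟩
    · exact hC' (Sum.inr l) (Or.inr ⟨l, rfl, hv⟩) (Sum.inr l) ⟨l, rfl⟩ hlJ (ReachIn.refl _ _ _)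
    · exact hC' a ha (Sum.inr l) ⟨l, rfl⟩ haC
        (har.tail (b := Sum.inl v) (c := Sum.inr l) ⟨hvU, hv⟩ (har.mem haC) hlJ))
  have htrim : ∀ i, ∃ (R : Set V) (l : Λ), Sum.inl '' R ⊆ P i ∧ Sum.inr l ∈ P i ∧ R ⊆ U \ {z} ∧
      ((R = ∅ ∧ z ∈ N l) ∨
        (ConnOn G R ∧ (∃ u ∈ R, G.Adj z u) ∧ (R ∩ N l).Nonempty)) := by
    intro i
    obtain ⟨hc, ⟨a, haP, haA⟩, hB⟩ := hP i
    obtain ⟨R, t, ⟨l, rfl⟩, htP, hRP, hR⟩ := hc.trim haP haA hB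
    have hl : ∀ w ∈ R, ∃ v, w = Sum.inl v := by
      rintro (v | l') hw
      · exact ⟨v, rfl⟩
      · exact ((hRP hw).2 ⟨l', rfl⟩).elim
    refine ⟨Sum.inl ⁻¹' R, l, ?_, htP, ?_⟩
    · rintro _ ⟨v, hv, rfl⟩
      exact (hRP hv).1
    rcases hR with ⟨rfl, htA⟩ | ⟨hRc, ⟨w, hwR, hwA⟩, u, huR, hul⟩
    · refine ⟨by simp, Or.inl ⟨rfl, ?_⟩⟩
      rcases htA with ⟨v, hv, _⟩ | ⟨l', hl', hz⟩
      · cases hv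
      · rwa [Sum.inr_injective hl']
    · obtain ⟨v, rfl⟩ := hl w hwR
      obtain ⟨u, rfl⟩ := hl u huR
      have hv : v ∈ U \ {z} ∧ G.Adj z v := by
        rcases hwA with ⟨v', hv', h⟩ | ⟨l', hl', _⟩
        · rwa [Sum.inl_injective hv']
        · cases hl'
      refine ⟨?_, Or.inr ⟨connOn_preimage_inl hRc hl, ⟨v, hwR, hv.2⟩, u, huR, hul.2⟩⟩
      intro b hb
      have : Sum.inl b ∈ ((Sum.inl '' (U \ {z}) : Set (V ⊕ Λ))) := by
        refine (hRc _ hwR _ hb).mem_of_closed ⟨v, hv.1, rfl⟩ ?_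
        rintro _ ⟨p, hp, rfl⟩ q _ hq hpq
        obtain ⟨q, rfl⟩ := hl q hq
        exact ⟨q, hpq.2.2, rfl⟩
      obtain ⟨b', hb', h⟩ := this
      rwa [← Sum.inl_injective h]
  choose R t hRP htP hRU hR using htrim
  have htinj : Function.Injective t := by
    intro i j hij
    by_contra hne
    exact Set.disjoint_left.1 (hPd i j hne) (htP i) (hij ▸ htP j)
  have htsurj : Function.Surjective t := by
    have e := (Finite.equivFin Λ)
    have : Function.Bijective (e ∘ t) := by
      rw [← Finite.injective_iff_bijective]
      exact e.injective.comp htinj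
    intro l
    obtain ⟨i, hi⟩ := this.2 (e l)
    exact ⟨i, e.injective hi⟩
  choose σ hσ using htsurj
  refine ⟨fun l => R (σ l), ?_, ?_⟩
  · intro i j hij
    rw [Set.disjoint_left]
    intro v hv hv'
    have hne : σ i ≠ σ j := fun h => hij (by rw [← hσ i, ← hσ j, h])
    exact Set.disjoint_left.1 (hPd _ _ hne) (hRP _ ⟨v, hv, rfl⟩) (hRP _ ⟨v, hv', rfl⟩)
  · intro l
    have := hR (σ l)
    rw [hσ l] at this
    exact ⟨hRU _, this⟩

end Fan

section TreePackings

variable {V : Type*} {G : SimpleGraph V} {S : Set V}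

theorem exists_tree_subgraph [Finite V] {Γ : SimpleGraph V} {W : Set V}
    (hΓ : ∀ u v, Γ.Adj u v → G.Adj u v) (hW : ConnOn Γ W) (hne : W.Nonempty) :
    ∃ T : G.Subgraph, T.coe.IsTree ∧ T.verts = W ∧ ∀ u v, T.Adj u v → Γ.Adj u v := by
  have hconn : (Γ.induce W).Connected := by
    have : Nonempty W := hne.to_subtype
    refine ⟨fun ⟨a, ha⟩ ⟨b, hb⟩ => ?_⟩
    have key : ∀ c, ReachIn Γ W a c → ∃ hc : c ∈ W, (Γ.induce W).Reachable ⟨a, ha⟩ ⟨c, hc⟩ := by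
      intro c hc
      induction hc with
      | refl => exact ⟨ha, SimpleGraph.Reachable.refl _⟩
      | tail _ h ih =>
        obtain ⟨hc, hr⟩ := ih
        exact ⟨h.2.2, hr.trans (SimpleGraph.Adj.reachable h.1)⟩
    exact (key b (hW a ha b hb)).2
  obtain ⟨T, hT, hTt⟩ := hconn.exists_isTree_le
  refine ⟨⟨W, fun u v => ∃ hu hv, T.Adj ⟨u, hu⟩ ⟨v, hv⟩, ?_, ?_, ?_⟩, ?_, rfl, ?_⟩
  · rintro u v ⟨hu, hv, h⟩
    exact hΓ _ _ (hT h)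
  · rintro u v ⟨hu, _⟩
    exact hu
  · exact ⟨fun u v ⟨hu, hv, h⟩ => ⟨hv, hu, h.symm⟩⟩
  · convert hTt
    ext ⟨u, hu⟩ ⟨v, hv⟩
    exact ⟨fun ⟨_, _, h⟩ => h, fun h => ⟨hu, hv, h⟩⟩
  · rintro u v ⟨hu, hv, h⟩
    exact hT h

theorem connectsSet_of_connOn [Finite V] {Θ : Type*} [Finite Θ] (Γ : Θ → SimpleGraph V)
    (W : Θ → Set V) (hS0 : S.Nonempty) (hΓ : ∀ i u v, (Γ i).Adj u v → G.Adj u v)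
    (hW : ∀ i, ConnOn (Γ i) (W i)) (hS : ∀ i, S ⊆ W i)
    (hWW : ∀ i j, i ≠ j → W i ∩ W j ⊆ S)
    (hE : ∀ i j, i ≠ j → ∀ a ∈ S, ∀ b ∈ S, ¬ ((Γ i).Adj a b ∧ (Γ j).Adj a b))
    {m : ℕ} (hm : m ≤ Nat.card Θ) : ConnectsSet G S m := by
  have e := Finite.equivFin Θ
  let f : Fin m → Θ := fun i => e.symm (Fin.castLE hm i)
  have hf : ∀ i j, i ≠ j → f i ≠ f j := fun i j hij h =>
    hij (Fin.castLE_injective hm (e.symm.injective h))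
  choose T hT hTW hTΓ using fun i => exists_tree_subgraph (hΓ i) (hW i) (hS0.mono (hS i))
  refine ⟨fun i => T (f i), fun i => hT _, fun i => ?_, fun i j hij => ?_, fun i j hij => ?_⟩
  · rw [hTW]
    exact hS _
  · rw [hTW, hTW]
    exact Set.Subset.antisymm (hWW _ _ (hf i j hij)) (Set.subset_inter (hS _) (hS _))
  · rw [Set.disjoint_left]
    intro e
    induction e with
    | _ u v =>
    intro h1 h2
    have h1 : (T (f i)).Adj u v := h1
    have h2 : (T (f j)).Adj u v := h2
    have hu : u ∈ S := hWW _ _ (hf i j hij) (by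
      rw [← hTW, ← hTW]
      exact ⟨h1.fst_mem, h2.fst_mem⟩)
    have hv : v ∈ S := hWW _ _ (hf i j hij) (by
      rw [← hTW, ← hTW]
      exact ⟨h1.snd_mem, h2.snd_mem⟩)
    exact hE _ _ (hf i j hij) u hu v hv ⟨hTΓ _ _ _ h1, hTΓ _ _ _ h2⟩

theorem ConnectsSet.exists_connOn {m : ℕ} (h : ConnectsSet G S m) :
    ∃ (Γ : Fin m → SimpleGraph V) (W : Fin m → Set V), (∀ i u v, (Γ i).Adj u v → G.Adj u v) ∧
      (∀ i, ConnOn (Γ i) (W i)) ∧ (∀ i, S ⊆ W i) ∧ (∀ i j, i ≠ j → W i ∩ W j ⊆ S) ∧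
      ∀ i j, i ≠ j → ∀ a b, ¬ ((Γ i).Adj a b ∧ (Γ j).Adj a b) := by
  obtain ⟨T, hT, hS, hTT, hE⟩ := h
  refine ⟨fun i => (T i).spanningCoe, fun i => (T i).verts, fun i u v h => h.adj_sub, ?_, hS,
    fun i j hij => (hTT i j hij).le, ?_⟩
  · intro i a ha b hb
    have hr := (hT i).connected.preconnected ⟨a, ha⟩ ⟨b, hb⟩
    rw [SimpleGraph.reachable_iff_reflTransGen] at hr
    have key : ∀ c, Relation.ReflTransGen (T i).coe.Adj ⟨a, ha⟩ c →
        ReachIn (T i).spanningCoe (T i).verts a c := by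
      intro c hc
      induction hc with
      | refl => exact ReachIn.refl _ _ _
      | @tail p q _ h ih => exact ih.tail h p.2 q.2
    exact key _ hr
  · intro i j hij a b hab
    exact Set.disjoint_left.1 (hE i j hij) (show s(a, b) ∈ (T i).edgeSet from hab.1) hab.2

end TreePackings

/-- The vertices of copy `i` having a neighbour in copy `j`. -/
def portSet {V I : Type*} (G : SimpleGraph V) (part : V → I) (i j : I) : Set V :=
  {v | part v = i ∧ ∃ w, G.Adj v w ∧ part w = j}

/-- One level of a recursive family: `k`-connected copies, each vertex has exactly
two outside neighbours, in distinct other copies, and there are equally many, at least `k + 2`,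
edges between any two copies. -/
structure CopyFamily {V I : Type*} (G : SimpleGraph V) (part : V → I) (k : ℕ) : Prop where
  four_le : 4 ≤ k
  conn : ∀ i C, C.ncard < k → ConnOn G ({v | part v = i} \ C)
  card : ∀ i, k < {v | part v = i}.ncard
  out : ∀ v, ∃ w₁ w₂, w₁ ≠ w₂ ∧ G.Adj v w₁ ∧ G.Adj v w₂ ∧
      part w₁ ≠ part v ∧ part w₂ ≠ part v ∧ part w₁ ≠ part w₂ ∧
      (∀ w, G.Adj v w → part w ≠ part v → w = w₁ ∨ w = w₂)
  edges : ∀ i j, i ≠ j → k + 2 ≤ (portSet G part i j).ncard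
  edges_eq : ∀ i j l, j ≠ i → l ≠ i → (portSet G part i j).ncard = (portSet G part i l).ncard

namespace CopyFamily

variable {V I : Type*} {G : SimpleGraph V} {part : V → I} {k : ℕ}

theorem out_unique (h : CopyFamily G part k) {v w w' : V} (hw : G.Adj v w) (hw' : G.Adj v w')
    (hp : part w ≠ part v) (hpp : part w = part w') : w = w' := by
  obtain ⟨w₁, w₂, -, -, -, -, -, h12, hall⟩ := h.out v
  rcases hall w hw hp with rfl | rfl <;> rcases hall w' hw' (hpp ▸ hp) with rfl | rfl
  · rfl
  · exact (h12 hpp).elim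
  · exact (h12 hpp.symm).elim
  · rfl

theorem mate_unique (h : CopyFamily G part k) {u v w : V} (hu : G.Adj u w) (hv : G.Adj v w)
    (hp : part w ≠ part u) (hpp : part u = part v) : u = v :=
  h.out_unique hu.symm hv.symm hp.symm hpp

theorem exists_out (h : CopyFamily G part k) (v : V) (F : I) :
    ∃ w, G.Adj v w ∧ part w ≠ part v ∧ part w ≠ F := by
  obtain ⟨w₁, w₂, -, h1, h2, hp1, hp2, h12, -⟩ := h.out v
  by_cases hF : part w₁ = F
  · exact ⟨w₂, h2, hp2, fun h => h12 (hF.trans h.symm)⟩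
  · exact ⟨w₁, h1, hp1, hF⟩

/-- An outside neighbour avoiding a given vertex. -/
theorem exists_out_ne (h : CopyFamily G part k) (v c : V) :
    ∃ w, G.Adj v w ∧ part w ≠ part v ∧ w ≠ c := by
  obtain ⟨w, h1, h2, h3⟩ := h.exists_out v (part c)
  exact ⟨w, h1, h2, fun h => h3 (h ▸ rfl)⟩

/-- A vertex has no outside neighbours in three different copies. -/
theorem not_three_outs (h : CopyFamily G part k) {v u₁ u₂ u₃ : V} (h1 : G.Adj v u₁)
    (h2 : G.Adj v u₂) (h3 : G.Adj v u₃) (p1 : part u₁ ≠ part v) (p2 : part u₂ ≠ part v)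
    (p3 : part u₃ ≠ part v) (h12 : part u₁ ≠ part u₂) (h13 : part u₁ ≠ part u₃)
    (h23 : part u₂ ≠ part u₃) : False := by
  obtain ⟨w₁, w₂, -, -, -, -, -, -, hall⟩ := h.out v
  rcases hall _ h1 p1 with rfl | rfl <;> rcases hall _ h2 p2 with rfl | rfl <;>
    rcases hall _ h3 p3 with rfl | rfl <;> simp_all

theorem conn' (h : CopyFamily G part k) (i : I) (C : Set V)
    (hC : (C ∩ {v | part v = i}).ncard < k) : ConnOn G ({v | part v = i} \ C) := by
  have := h.conn i _ hC
  rwa [show {v | part v = i} \ (C ∩ {v | part v = i}) = {v | part v = i} \ C by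
    ext; simp] at this

variable [Finite V]

theorem exists_edge_avoiding (h : CopyFamily G part k) {i j : I} (hij : i ≠ j) {C : Set V}
    (hC : C.ncard ≤ k + 1) :
    ∃ u v, part u = i ∧ part v = j ∧ G.Adj u v ∧ u ∉ C ∧ v ∉ C := by
  classical
  by_contra! hcon
  have hm : ∀ a : portSet G part i j, ∃ w, G.Adj a.1 w ∧ part w = j := fun a => a.2.2
  choose m hm hmj using hm
  have hlt : (portSet G part i j).ncard ≤ C.ncard := by
    rw [← Nat.card_coe_set_eq, ← Nat.card_coe_set_eq]
    refine Nat.card_le_card_of_injective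
      (fun a => if ha : a.1 ∈ C then (⟨a.1, ha⟩ : C) else
        ⟨m a, hcon a.1 (m a) a.2.1 (hmj a) (hm a) ha⟩) ?_
    intro a b hab
    have hne : ∀ a b : portSet G part i j, m a ≠ b.1 := fun a b h => hij (by rw [← hmj a, h, b.2.1])
    dsimp only at hab
    split_ifs at hab with h1 h2 h2
    · exact Subtype.ext (congrArg (Subtype.val : C → V) hab)
    · exact (hne b a (congrArg (Subtype.val : C → V) hab).symm).elim
    · exact (hne a b (congrArg (Subtype.val : C → V) hab)).elim
    · have h3 : m a = m b := congrArg (Subtype.val : C → V) hab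
      refine Subtype.ext (h.mate_unique (hm a) (h3 ▸ hm b) ?_ (a.2.1.trans b.2.1.symm))
      rw [hmj, a.2.1]
      exact hij.symm
  have := h.edges i j hij
  omega

theorem conn_union (h : CopyFamily G part k) (J : Set I) (C : Set V)
    (hJ : ∀ i ∈ J, (C ∩ {v | part v = i}).ncard < k) (hC : C.ncard ≤ k + 1) :
    ConnOn G ({v | part v ∈ J} \ C) := by
  rintro a ⟨ha, haC⟩ b ⟨hb, hbC⟩
  have key : ∀ i ∈ J, ∀ u v, part u = i → part v = i → u ∉ C → v ∉ C →
      ReachIn G ({v | part v ∈ J} \ C) u v := by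
    intro i hi u v hu hv huC hvC
    refine (h.conn' i C (hJ i hi) u ⟨hu, huC⟩ v ⟨hv, hvC⟩).mono ?_
    rintro w ⟨hw, hwC⟩
    exact ⟨by rw [Set.mem_ofPred_eq, show part w = i from hw]; exact hi, hwC⟩
  by_cases hab : part a = part b
  · exact key _ ha a b rfl hab.symm haC hbC
  · obtain ⟨u, v, hu, hv, huv, huC, hvC⟩ := h.exists_edge_avoiding hab hC
    refine (key _ ha a u rfl hu haC huC).trans (ReachIn.trans ?_ (key _ hb v b hv rfl hvC hbC))
    refine ReachIn.single huv ⟨?_, huC⟩ ⟨?_, hvC⟩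
    · rw [Set.mem_ofPred_eq, hu]; exact ha
    · rw [Set.mem_ofPred_eq, hv]; exact hb

theorem conn_union_all (h : CopyFamily G part k) (J : Set I) : ConnOn G {v | part v ∈ J} := by
  have := h.four_le
  simpa using h.conn_union J ∅ (by intro i _; simp; omega) (by simp)

end CopyFamily

namespace CopyFamily

variable {V I : Type*} {G : SimpleGraph V} {part : V → I} {k : ℕ}

/-- If a reached vertex sees a vertex outside the removed set in a copy of `x` or `y`, then
one of the core targets is reached. -/
theorem reach_core_of_adj [Finite V] {Λ : Type*} (h : CopyFamily G part k) {x y z d w : V}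
    {U C : Set V} {N : Λ → Set V} {core : Set Λ}
    (hQ : ∀ v ∈ U, ∀ q, q ∉ U → q ≠ x → q ≠ y → G.Adj v q → ∃ l ∈ core, v ∈ N l)
    (hq : ∃ q, part q = part d ∧ q ∉ U ∧ q ≠ x ∧ q ≠ y)
    (hCU : C ⊆ U) (hzU : z ∈ U \ C) (hcard : (C ∩ {v | part v = part d}).ncard ≤ 1)
    (hw : ReachIn G (U \ C) z w) (hwd : G.Adj w d) (hdx : d ≠ x) (hdy : d ≠ y) (hdC : d ∉ C) :
    ∃ l ∈ core, ∃ v ∈ N l, ReachIn G (U \ C) z v := by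
  have hwU := hw.mem hzU
  by_cases hdU : d ∉ U
  · obtain ⟨l, hl, hv⟩ := hQ w hwU.1 d hdU hdx hdy hwd
    exact ⟨l, hl, w, hv, hw⟩
  push Not at hdU
  have hd : ReachIn G (U \ C) z d := hw.tail hwd hwU ⟨hdU, hdC⟩
  obtain ⟨q, hqd, hqU, hqx, hqy⟩ := hq
  have hK := h.conn' (part d) (C ∪ {x, y}) (by
    have h1 : ((C ∪ {x, y}) ∩ {v | part v = part d}).ncard ≤
        ((C ∩ {v | part v = part d}) ∪ {x, y}).ncard := by
      refine Set.ncard_le_ncard ?_ (Set.toFinite _)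
      rintro v ⟨hv | hv, hvd⟩
      · exact Or.inl ⟨hv, hvd⟩
      · exact Or.inr hv
    have h2 := Set.ncard_union_le (C ∩ {v | part v = part d}) {x, y}
    have h3 := Set.ncard_insert_le x {y}
    have h4 := Set.ncard_singleton y
    have := h.four_le
    omega)
  have hr := hK d ⟨rfl, by simp [hdC, hdx, hdy]⟩ q
    ⟨hqd, by simp only [Set.mem_union, not_or]; exact ⟨fun h => hqU (hCU h), by simp [hqx, hqy]⟩⟩
  by_contra! hcon
  have : q ∈ {v | ReachIn G (U \ C) z v} := by
    refine hr.mem_of_closed hd ?_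
    rintro u hu v - ⟨-, hv⟩ huv
    have huU := ReachIn.mem hu hzU
    simp only [Set.mem_union, not_or, Set.mem_insert_iff, Set.mem_singleton_iff] at hv
    by_cases hvU : v ∈ U
    · exact ReachIn.tail hu huv huU ⟨hvU, hv.1⟩
    · obtain ⟨l, hl, hul⟩ := hQ u huU.1 v hvU hv.2.1 hv.2.2 huv
      exact (hcon l hl u hul hu).elim
  exact hqU (ReachIn.mem this hzU).1

/-- Verification of the separator condition needed to run a fan from `z` outside the copies
of `x` and `y`. -/
theorem fan_condition [Finite V] {Λ : Type*} [Finite Λ] (h : CopyFamily G part k) {x y z : V}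
    (hzx : part z ≠ part x) (hzy : part z ≠ part y) {U : Set V}
    (hHU : ∀ v, part v ≠ part x → part v ≠ part y → v ∈ U)
    (N : Λ → Set V) (e : Λ → V) (he : Function.Injective e)
    (heN : ∀ l, e l ∈ N l ∧ part (e l) ≠ part x ∧ part (e l) ≠ part y) (core : Set Λ)
    (hQ : ∀ v ∈ U, ∀ q, q ∉ U → q ≠ x → q ≠ y → G.Adj v q → ∃ l ∈ core, v ∈ N l)
    (hqx : ∃ q, part q = part x ∧ q ∉ U ∧ q ≠ x ∧ q ≠ y)
    (hqy : ∃ q, part q = part y ∧ q ∉ U ∧ q ≠ x ∧ q ≠ y)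
    (hz : ∀ w, G.Adj z w → w = x ∨ w = y → ∃ l, z ∈ N l)
    (hm : Nat.card Λ = k + 1 ∨ (Nat.card Λ = k + 2 ∧
      (∃ w, G.Adj z w ∧ part w ≠ part z ∧ part w ≠ part x ∧ part w ≠ part y) ∧
      ∃ l ∉ core, ∀ F, ∃ v ∈ N l, part v ≠ part x ∧ part v ≠ part y ∧ part v ≠ F)) :
    ∀ C ⊆ U \ {z}, ∀ J : Set Λ, C.ncard + J.ncard < Nat.card Λ →
      ∃ l, l ∉ J ∧ ∃ v ∈ N l, ReachIn G (U \ C) z v := by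
  intro C hC J hCJ
  have h4 := h.four_le
  have hCU : C ⊆ U := hC.trans Set.sdiff_subset
  have hzU : z ∈ U \ C := ⟨hHU z hzx hzy, fun hzC => (hC hzC).2 rfl⟩
  have hCk : C.ncard ≤ k + 1 := by rcases hm with hm | hm <;> omega
  by_cases hF : ∀ F, F ≠ part x → F ≠ part y → (C ∩ {v | part v = F}).ncard < k
  · have hconn := h.conn_union {F | F ≠ part x ∧ F ≠ part y} C (fun F hF' => hF F hF'.1 hF'.2) hCk
    obtain ⟨l, hlJ, hlC⟩ : ∃ l, l ∉ J ∧ e l ∉ C := by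
      by_contra! hcon
      have h1 : (Set.univ : Set Λ).ncard ≤ (J ∪ e ⁻¹' C).ncard :=
        Set.ncard_le_ncard (fun l _ => by
          by_cases hl : l ∈ J
          · exact Or.inl hl
          · exact Or.inr (hcon l hl)) (Set.toFinite _)
      have h2 := Set.ncard_union_le J (e ⁻¹' C)
      have h3 : (e ⁻¹' C).ncard ≤ C.ncard :=
        Set.ncard_le_ncard_of_injOn e (fun _ h => h) he.injOn (Set.toFinite _)
      rw [Set.ncard_univ] at h1
      omega
    refine ⟨l, hlJ, e l, (heN l).1, (hconn z ⟨⟨hzx, hzy⟩, hzU.2⟩ _ ⟨(heN l).2, hlC⟩).mono ?_⟩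
    exact fun v hv => ⟨hHU v hv.1.1 hv.1.2, hv.2⟩
  push Not at hF
  obtain ⟨F, hFx, hFy, hFk⟩ := hF
  have hsplit : (C ∩ {v | part v = F}).ncard + (C \ {v | part v = F}).ncard = C.ncard :=
    Set.ncard_inter_add_ncard_sdiff_eq_ncard C _ (Set.toFinite _)
  have hsub : ∀ i, i ≠ F → (C ∩ {v | part v = i}).ncard ≤ (C \ {v | part v = F}).ncard := by
    intro i hi
    refine Set.ncard_le_ncard ?_ (Set.toFinite _)
    rintro v ⟨hv, hvi⟩
    exact ⟨hv, fun hvF => hi (hvi.symm.trans hvF)⟩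
  have L1 : ∀ w d, ReachIn G (U \ C) z w → G.Adj w d → d ≠ x → d ≠ y → d ∉ C →
      (part d = part x ∨ part d = part y) → ∃ l ∈ core, ∃ v ∈ N l, ReachIn G (U \ C) z v := by
    intro w d hw hwd hdx hdy hdC hd
    refine h.reach_core_of_adj hQ ?_ hCU hzU ?_ hw hwd hdx hdy hdC
    · rcases hd with hd | hd <;> rw [hd] <;> assumption
    · have := hsub (part d) (by rcases hd with hd | hd <;> rw [hd] <;> exact Ne.symm ‹_›)
      omega
  have L2 : ∀ w, ReachIn G (U \ C) z w → part w ≠ part x → part w ≠ part y → part w ≠ F →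
      ∃ l ∈ core, ∃ v ∈ N l, ReachIn G (U \ C) z v := by
    intro w hw hwx hwy hwF
    obtain ⟨u, d, hu, hd, hud, huC, hdC⟩ :=
      h.exists_edge_avoiding hwx (C := (C \ {v | part v = F}) ∪ {x, y}) (by
        have h2 := Set.ncard_union_le (C \ {v | part v = F}) {x, y}
        have h3 := Set.ncard_insert_le x {y}
        have h4 := Set.ncard_singleton y
        omega)
    have hu' : u ∉ C := fun h => huC (Or.inl ⟨h, fun h' => hwF (hu.symm.trans h')⟩)
    have hd' : d ∉ C := fun h => hdC (Or.inl ⟨h, fun h' => hFx (h'.symm.trans hd)⟩)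
    have hwu := h.conn' (part w) C (by have := hsub _ hwF; omega) w
      ⟨rfl, (hw.mem hzU).2⟩ u ⟨hu, hu'⟩
    refine L1 u d (hw.trans (hwu.mono ?_)) hud ?_ ?_ hd' (Or.inl hd)
    · rintro v ⟨hv, hvC⟩
      have hv : part v = part w := hv
      exact ⟨hHU v (hv ▸ hwx) (hv ▸ hwy), hvC⟩
    · rintro rfl; simp at hdC
    · rintro rfl; simp at hdC
  by_cases hJ : J = ∅
  · suffices ∃ l, ∃ v ∈ N l, ReachIn G (U \ C) z v by
      obtain ⟨l, hl⟩ := this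
      exact ⟨l, by simp [hJ], hl⟩
    by_cases hzF : part z ≠ F
    · obtain ⟨l, -, hl⟩ := L2 z (ReachIn.refl _ _ _) hzx hzy hzF
      exact ⟨l, hl⟩
    push Not at hzF
    obtain ⟨w, hzw, hwz, hwC⟩ : ∃ w, G.Adj z w ∧ part w ≠ part z ∧ w ∉ C := by
      obtain ⟨w₁, w₂, hne, h1, h2, p1, p2, -, -⟩ := h.out z
      by_contra! hcon
      have : ({w₁, w₂} : Set V) ⊆ C \ {v | part v = F} := by
        rintro v (rfl | rfl)
        · exact ⟨hcon _ h1 p1, fun h => p1 (h.trans hzF.symm)⟩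
        · exact ⟨hcon _ h2 p2, fun h => p2 (h.trans hzF.symm)⟩
      have := Set.ncard_le_ncard this (Set.toFinite _)
      rw [Set.ncard_pair hne] at this
      omega
    by_cases hwxy : w = x ∨ w = y
    · obtain ⟨l, hl⟩ := hz w hzw hwxy
      exact ⟨l, z, hl, ReachIn.refl _ _ _⟩
    push Not at hwxy
    by_cases hwp : part w = part x ∨ part w = part y
    · obtain ⟨l, -, hl⟩ := L1 z w (ReachIn.refl _ _ _) hzw hwxy.1 hwxy.2 hwC hwp
      exact ⟨l, hl⟩
    push Not at hwp
    obtain ⟨l, -, hl⟩ := L2 w (ReachIn.single hzw hzU ⟨hHU w hwp.1 hwp.2, hwC⟩) hwp.1 hwp.2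
      (hzF ▸ hwz)
    exact ⟨l, hl⟩
  have hJ1 : 1 ≤ J.ncard := by
    rw [Nat.one_le_iff_ne_zero, Ne, Set.ncard_eq_zero (Set.toFinite _)]
    exact hJ
  obtain ⟨hcard, ⟨w, hzw, hwz, hwx, hwy⟩, l, hlc, hl⟩ : _ ∧ _ :=
    hm.resolve_left (by omega)
  have hCF : ∀ v ∈ C, part v = F := by
    have : C \ {v | part v = F} = ∅ := by
      rw [← Set.ncard_eq_zero (Set.toFinite _)]
      omega
    intro v hv
    by_contra hvF
    have : v ∈ (∅ : Set V) := this ▸ ⟨hv, hvF⟩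
    exact this
  obtain ⟨b, hzb, hbx, hby, hbF⟩ : ∃ b, ReachIn G (U \ C) z b ∧ part b ≠ part x ∧
      part b ≠ part y ∧ part b ≠ F := by
    by_cases hzF : part z = F
    · refine ⟨w, ReachIn.single hzw hzU ⟨hHU w hwx hwy, fun hwC => ?_⟩, hwx, hwy, hzF ▸ hwz⟩
      exact hwz ((hCF w hwC).trans hzF.symm)
    · exact ⟨z, ReachIn.refl _ _ _, hzx, hzy, hzF⟩
  obtain ⟨l', hl'c, hl'⟩ := L2 b hzb hbx hby hbF
  obtain ⟨v, hvl, hvx, hvy, hvF⟩ := hl F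
  have hempty : ∀ i, i ≠ F → C ∩ {v | part v = i} = ∅ := by
    intro i hi
    ext v
    simp only [Set.mem_inter_iff, Set.mem_empty_iff_false, iff_false, not_and]
    exact fun hv hvi => hi (hvi.symm.trans (hCF v hv))
  have hconn := h.conn_union {i | i ≠ part x ∧ i ≠ part y ∧ i ≠ F} C
    (fun i hi => by rw [hempty i hi.2.2]; simp; omega) hCk
  have hv : ReachIn G (U \ C) z v := by
    refine hzb.trans ((hconn b ⟨⟨hbx, hby, hbF⟩, fun h => hbF (hCF _ h)⟩ v
      ⟨⟨hvx, hvy, hvF⟩, fun h => hvF (hCF _ h)⟩).mono ?_)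
    exact fun v hv => ⟨hHU v hv.1.1 hv.1.2.1, hv.2⟩
  by_cases hlJ : l ∈ J
  · refine ⟨l', fun hl'J => ?_, hl'⟩
    have hne : l ≠ l' := fun h => hlc (h ▸ hl'c)
    have : ({l, l'} : Set Λ) ⊆ J := by
      rintro _ (rfl | rfl) <;> assumption
    have := Set.ncard_le_ncard this (Set.toFinite _)
    rw [Set.ncard_pair hne] at this
    omega
  · exact ⟨l, hlJ, v, hvl, hv⟩

end CopyFamily

namespace CopyFamily

variable {V I : Type*} {G : SimpleGraph V} {part : V → I} {k : ℕ}

/-- Trees through `x` and `y`, built from connected pieces `B l` inside the copies of `x` and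
`y`, are extended to a vertex `z` of another copy by a fan. -/
theorem connectsSet_of_pieces [Finite V] {Λ Θ : Type*} [Finite Λ] [Finite Θ] [Nonempty Θ]
    (h : CopyFamily G part k) {x y z : V} (hzx : part z ≠ part x) (hzy : part z ≠ part y)
    (τ : Λ → Θ) (B : Λ → Set V) (Γ : Θ → SimpleGraph V)
    (hB : ∀ l, ∀ v ∈ B l, part v = part x ∨ part v = part y)
    (hBB : ∀ l l', l ≠ l' → B l ∩ B l' ⊆ {x, y})
    (hBc : ∀ l, ConnOn (Γ (τ l)) (B l))
    (hxB : ∀ θ, ∃ l, τ l = θ ∧ x ∈ B l) (hyB : ∀ θ, ∃ l, τ l = θ ∧ y ∈ B l)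
    (hΓ : ∀ θ u v, (Γ θ).Adj u v → G.Adj u v)
    (hΓ0 : ∀ θ u v, G.Adj u v → ¬ (u ∈ ({x, y, z} : Set V) ∧ v ∈ ({x, y, z} : Set V)) →
      (Γ θ).Adj u v)
    (hΓΓ : ∀ θ θ', θ ≠ θ' → ∀ u ∈ ({x, y, z} : Set V), ∀ v ∈ ({x, y, z} : Set V),
      ¬ ((Γ θ).Adj u v ∧ (Γ θ').Adj u v))
    (e : Λ → V) (he : Function.Injective e)
    (heB : ∀ l, (∃ u ∈ B l, (Γ (τ l)).Adj u (e l)) ∧ part (e l) ≠ part x ∧ part (e l) ≠ part y)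
    (hqx : ∃ l, ∃ q ∈ B l, part q = part x ∧ q ≠ x ∧ q ≠ y)
    (hqy : ∃ l, ∃ q ∈ B l, part q = part y ∧ q ≠ x ∧ q ≠ y)
    (hz : ∀ w, G.Adj z w → w = x ∨ w = y → ∃ l, ∃ u ∈ B l, (Γ (τ l)).Adj u z)
    (hm : Nat.card Λ = k + 1 ∨ (Nat.card Λ = k + 2 ∧
      (∃ w, G.Adj z w ∧ part w ≠ part z ∧ part w ≠ part x ∧ part w ≠ part y) ∧
      ∃ l, (∀ v ∈ B l, v = x ∨ v = y) ∧ ∀ F, ∃ v, part v ≠ part x ∧ part v ≠ part y ∧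
        part v ≠ F ∧ ∃ u ∈ B l, (Γ (τ l)).Adj u v))
    {m : ℕ} (hmΘ : m ≤ Nat.card Θ) : ConnectsSet G {x, y, z} m := by
  classical
  set U : Set V := (⋃ l, B l)ᶜ with hU
  have hBU : ∀ l, ∀ v ∈ B l, v ∉ U := fun l v hv h => h (Set.mem_iUnion.2 ⟨l, hv⟩)
  have hUB : ∀ v, v ∉ U → ∃ l, v ∈ B l := fun v hv =>
    Set.mem_iUnion.1 (by simpa [hU] using hv)
  have hHU : ∀ v, part v ≠ part x → part v ≠ part y → v ∈ U := by
    intro v hvx hvy hv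
    obtain ⟨l, hl⟩ := Set.mem_iUnion.1 hv
    exact (hB l v hl).elim hvx hvy
  have hxU : x ∉ U := by
    obtain ⟨l, -, hl⟩ := hxB (Classical.arbitrary Θ)
    exact hBU l x hl
  have hyU : y ∉ U := by
    obtain ⟨l, -, hl⟩ := hyB (Classical.arbitrary Θ)
    exact hBU l y hl
  have hzU : z ∈ U := hHU z hzx hzy
  have hS : ∀ v ∈ U \ {z}, v ∉ ({x, y, z} : Set V) := by
    rintro v ⟨hv, hvz⟩ (rfl | rfl | rfl)
    · exact hxU hv
    · exact hyU hv
    · exact hvz rfl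
  let N : Λ → Set V := fun l => {v | v ∈ U ∧ ∃ u ∈ B l, (Γ (τ l)).Adj u v}
  obtain ⟨R, hRd, hR⟩ := exists_fan G U z N
    (h.fan_condition hzx hzy hHU N e he
      (fun l => ⟨⟨hHU _ (heB l).2.1 (heB l).2.2, (heB l).1⟩, (heB l).2⟩)
      {l | ∃ q ∈ B l, q ≠ x ∧ q ≠ y}
      (by
        intro v hv q hq hqx hqy hvq
        obtain ⟨l, hl⟩ := hUB q hq
        refine ⟨l, ⟨q, hl, hqx, hqy⟩, hv, q, hl, hΓ0 _ _ _ hvq.symm ?_⟩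
        rintro ⟨rfl | rfl | rfl, -⟩
        · exact hqx rfl
        · exact hqy rfl
        · exact hq hzU)
      (by
        obtain ⟨l, q, hq, hqp, hq'⟩ := hqx
        exact ⟨q, hqp, hBU l q hq, hq'⟩)
      (by
        obtain ⟨l, q, hq, hqp, hq'⟩ := hqy
        exact ⟨q, hqp, hBU l q hq, hq'⟩)
      (by
        intro w hw hwxy
        obtain ⟨l, hl⟩ := hz w hw hwxy
        exact ⟨l, hzU, hl⟩)
      (by
        refine hm.imp_right ?_
        rintro ⟨h1, h2, l, hl, hF⟩
        refine ⟨h1, h2, l, ?_, fun F => ?_⟩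
        · rintro ⟨q, hq, hqx, hqy⟩
          exact (hl q hq).elim hqx hqy
        · obtain ⟨v, hvx, hvy, hvF, hv⟩ := hF F
          exact ⟨v, ⟨hHU v hvx hvy, hv⟩, hvx, hvy, hvF⟩))
  have hpiece : ∀ l, ConnOn (Γ (τ l)) (insert z (B l ∪ R l)) := by
    intro l
    obtain ⟨hRU, ⟨hR0, -, u, hu, huz⟩ | ⟨hRc, ⟨u, hu, hzu⟩, v, hvR, -, w, hw, hwv⟩⟩ := hR l
    · rw [hR0, Set.union_empty]
      exact (hBc l).insert_of_adj hu huz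
    · have hRc' : ConnOn (Γ (τ l)) (R l) :=
        hRc.mono fun a ha b _ hab => hΓ0 _ _ _ hab fun hS' => hS a (hRU ha) hS'.1
      refine ((hBc l).union_of_adj hRc' hw hvR hwv).insert_of_adj (Or.inr hu) ?_
      exact hΓ0 _ _ _ hzu.symm fun hS' => hS u (hRU hu) hS'.1
  refine connectsSet_of_connOn Γ (fun θ => ⋃ l : {l // τ l = θ}, insert z (B l ∪ R l))
    ⟨x, by simp⟩ hΓ ?_ ?_ ?_ hΓΓ hmΘ
  · intro θ
    refine ConnOn.biUnion_of_mem z (fun l => Or.inl rfl) ?_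
    rintro ⟨l, rfl⟩
    exact hpiece l
  · intro θ
    obtain ⟨lx, hlx, hx⟩ := hxB θ
    obtain ⟨ly, hly, hy⟩ := hyB θ
    rintro v (rfl | rfl | rfl)
    · exact Set.mem_iUnion.2 ⟨⟨lx, hlx⟩, Or.inr (Or.inl hx)⟩
    · exact Set.mem_iUnion.2 ⟨⟨ly, hly⟩, Or.inr (Or.inl hy)⟩
    · exact Set.mem_iUnion.2 ⟨⟨lx, hlx⟩, Or.inl rfl⟩
  · rintro θ θ' hne v ⟨hv, hv'⟩
    obtain ⟨⟨l, hl⟩, hv⟩ := Set.mem_iUnion.1 hv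
    obtain ⟨⟨l', hl'⟩, hv'⟩ := Set.mem_iUnion.1 hv'
    have hll : l ≠ l' := by
      rintro rfl
      exact hne (hl.symm.trans hl')
    rcases hv with rfl | hv | hv
    · simp
    · rcases hv' with rfl | hv' | hv'
      · simp
      · rcases hBB l l' hll ⟨hv, hv'⟩ with rfl | rfl <;> simp
      · exact (hBU l v hv ((hR l').1 hv').1).elim
    · rcases hv' with rfl | hv' | hv'
      · simp
      · exact (hBU l' v hv' ((hR l).1 hv).1).elim
      · exact (Set.disjoint_left.1 (hRd l l' hll) hv hv').elim

end CopyFamily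

namespace CopyFamily

variable {V I : Type*} {G : SimpleGraph V} {part : V → I} {k : ℕ}

/-- `k` internally disjoint `x`-`y` links and two single legs at `x` and `y` give `k + 1` trees. -/
theorem connectsSet_of_links [Finite V] {ι : Type*} [Finite ι]
    (h : CopyFamily G part k) (hι : Nat.card ι = k) {x y z : V} (hxy : x ≠ y)
    (hzx : part z ≠ part x) (hzy : part z ≠ part y) (Q : ι → Set V)
    (hQD : ∀ i, ∀ v ∈ Q i, (part v = part x ∨ part v = part y) ∧ v ≠ x ∧ v ≠ y)
    (hQd : ∀ i j, i ≠ j → Disjoint (Q i) (Q j))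
    (hQc : ∀ i, (Q i = ∅ ∧ G.Adj x y) ∨
      (ConnOn G (Q i) ∧ (∃ u ∈ Q i, G.Adj x u) ∧ ∃ u ∈ Q i, G.Adj y u))
    (hQ0 : ∀ i j, Q i = ∅ → Q j = ∅ → i = j)
    (hqx : ∃ i, ∃ q ∈ Q i, part q = part x) (hqy : ∃ i, ∃ q ∈ Q i, part q = part y)
    (c : ι → V) (hc : Function.Injective c)
    (hcQ : ∀ i, ∃ u, (u ∈ Q i ∨ (Q i = ∅ ∧ u = x ∧ c i ≠ z)) ∧ G.Adj u (c i))
    (hcH : ∀ i, part (c i) ≠ part x ∧ part (c i) ≠ part y)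
    (ex ey : V) (hex : G.Adj x ex) (hey : G.Adj y ey)
    (hexH : part ex ≠ part x ∧ part ex ≠ part y) (heyH : part ey ≠ part x ∧ part ey ≠ part y)
    (hexy : ex ≠ ey) (hcx : ∀ i, c i ≠ ex) (hcy : ∀ i, c i ≠ ey)
    (hzo : ∃ w, G.Adj z w ∧ part w ≠ part z ∧ part w ≠ part x ∧ part w ≠ part y)
    (hxo : ∀ F, ∃ v, part v ≠ part x ∧ part v ≠ part y ∧ part v ≠ F ∧ G.Adj x v) :
    ConnectsSet G {x, y, z} (k + 1) := by
  classical
  have hxz : x ≠ z := fun h => hzx (h ▸ rfl)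
  have hyz : y ≠ z := fun h => hzy (h ▸ rfl)
  have hne : ∀ u, part u ≠ part x ∧ part u ≠ part y → u ≠ x ∧ u ≠ y := fun u hu =>
    ⟨fun h => hu.1 (h ▸ rfl), fun h => hu.2 (h ▸ rfl)⟩
  have hQS : ∀ i, ∀ v ∈ Q i, v ∉ ({x, y, z} : Set V) := by
    rintro i v hv (rfl | rfl | rfl)
    · exact (hQD i _ hv).2.1 rfl
    · exact (hQD i _ hv).2.2 rfl
    · exact (hQD i _ hv).1.elim hzx hzy
  let Γ : Option ι → SimpleGraph V := fun θ => match θ with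
    | some i => SimpleGraph.fromRel fun u v => G.Adj u v ∧
        (¬ (u ∈ ({x, y, z} : Set V) ∧ v ∈ ({x, y, z} : Set V)) ∨
          (Q i = ∅ ∧ u ∈ ({x, y} : Set V) ∧ v ∈ ({x, y} : Set V)))
    | none => SimpleGraph.fromRel fun u v => G.Adj u v ∧
        ¬ (u ∈ ({x, y} : Set V) ∧ v ∈ ({x, y} : Set V))
  have hΓs : ∀ i u v, (Γ (some i)).Adj u v ↔ G.Adj u v ∧
        (¬ (u ∈ ({x, y, z} : Set V) ∧ v ∈ ({x, y, z} : Set V)) ∨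
          (Q i = ∅ ∧ u ∈ ({x, y} : Set V) ∧ v ∈ ({x, y} : Set V))) := by
    intro i u v
    simp only [Γ, SimpleGraph.fromRel_adj]
    have := G.adj_comm u v
    have := G.ne_of_adj (a := u) (b := v)
    tauto
  have hΓn : ∀ u v, (Γ none).Adj u v ↔ G.Adj u v ∧
        ¬ (u ∈ ({x, y} : Set V) ∧ v ∈ ({x, y} : Set V)) := by
    intro u v
    simp only [Γ, SimpleGraph.fromRel_adj]
    have := G.adj_comm u v
    have := G.ne_of_adj (a := u) (b := v)
    tauto
  let τ : ι ⊕ Bool → Option ι := Sum.elim some fun _ => none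
  let B : ι ⊕ Bool → Set V := Sum.elim (fun i => insert x (insert y (Q i)))
    fun b => bif b then {x} else {y}
  have hQne : ∀ q i, q ∈ Q i → q ≠ x ∧ q ≠ y := fun q i hq => (hQD i q hq).2
  refine h.connectsSet_of_pieces hzx hzy τ B Γ ?_ ?_ ?_ ?_ ?_ ?_ ?_ ?_
    (Sum.elim c fun b => bif b then ex else ey) ?_ ?_ ?_ ?_ ?_ (Or.inr ⟨?_, hzo, ?_⟩) ?_
  · rintro (i | _ | _) v hv
    · rcases hv with rfl | rfl | hv
      · exact Or.inl rfl
      · exact Or.inr rfl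
      · exact (hQD i v hv).1
    · obtain rfl : v = y := hv
      exact Or.inr rfl
    · obtain rfl : v = x := hv
      exact Or.inl rfl
  · rintro (i | _ | _) (j | _ | _) hij v ⟨hv, hv'⟩
    · rcases hv with rfl | rfl | hv
      · simp
      · simp
      rcases hv' with rfl | rfl | hv'
      · simp
      · simp
      have hij : i ≠ j := fun h => hij (h ▸ rfl)
      exact (Set.disjoint_left.1 (hQd i j hij) hv hv').elim
    all_goals first
      | (obtain rfl : v = y := hv; simp)
      | (obtain rfl : v = x := hv; simp)
      | (obtain rfl : v = y := hv'; simp)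
      | (obtain rfl : v = x := hv'; simp)
  · rintro (i | _ | _)
    · rcases hQc i with ⟨h0, hadj⟩ | ⟨hconn, ⟨u, hu, hxu⟩, v, hv, hyv⟩
      · have : B (Sum.inl i) = insert x (insert y ∅) := by simp [B, h0]
        rw [this]
        refine ConnOn.insert_of_adj (u := y) (by simpa using ConnOn.singleton _ y) (Or.inl rfl) ?_
        exact (hΓs i _ _).2 ⟨hadj.symm, Or.inr ⟨h0, by simp, by simp⟩⟩
      · have h1 : ConnOn (Γ (some i)) (Q i) := hconn.mono fun a ha b _ hab =>
          (hΓs i _ _).2 ⟨hab, Or.inl fun hS => hQS i a ha hS.1⟩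
        have h2 := h1.insert_of_adj hv ((hΓs i _ _).2 ⟨hyv.symm, Or.inl fun hS => hQS i v hv hS.1⟩)
        exact h2.insert_of_adj (Or.inr hu)
          ((hΓs i _ _).2 ⟨hxu.symm, Or.inl fun hS => hQS i u hu hS.1⟩)
    · exact ConnOn.singleton _ _
    · exact ConnOn.singleton _ _
  · rintro (_ | i)
    · exact ⟨Sum.inr true, rfl, rfl⟩
    · exact ⟨Sum.inl i, rfl, Or.inl rfl⟩
  · rintro (_ | i)
    · exact ⟨Sum.inr false, rfl, rfl⟩
    · exact ⟨Sum.inl i, rfl, Or.inr (Or.inl rfl)⟩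
  · rintro (_ | i) u v huv
    · exact ((hΓn u v).1 huv).1
    · exact ((hΓs i u v).1 huv).1
  · rintro (_ | i) u v huv hS
    · refine (hΓn u v).2 ⟨huv, fun h => hS ⟨?_, ?_⟩⟩
      · rcases h.1 with rfl | rfl <;> simp
      · rcases h.2 with rfl | rfl <;> simp
    · exact (hΓs i u v).2 ⟨huv, Or.inl hS⟩
  · rintro (_ | i) (_ | j) hij u hu v hv ⟨h1, h2⟩
    · exact hij rfl
    · exact ((hΓn u v).1 h1).2 ((((hΓs j u v).1 h2).2.resolve_left fun h => h ⟨hu, hv⟩).2)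
    · exact ((hΓn u v).1 h2).2 ((((hΓs i u v).1 h1).2.resolve_left fun h => h ⟨hu, hv⟩).2)
    · refine hij (congrArg some (hQ0 i j ?_ ?_))
      · exact (((hΓs i u v).1 h1).2.resolve_left fun h => h ⟨hu, hv⟩).1
      · exact (((hΓs j u v).1 h2).2.resolve_left fun h => h ⟨hu, hv⟩).1
  · rintro (i | _ | _) (j | _ | _) hij
    · exact congrArg _ (hc hij)
    · exact (hcy i hij).elim
    · exact (hcx i hij).elim
    · exact (hcy j hij.symm).elim
    · rfl
    · exact (hexy hij.symm).elim
    · exact (hcx j hij.symm).elim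
    · exact (hexy hij).elim
    · rfl
  · rintro (i | _ | _)
    · refine ⟨?_, hcH i⟩
      obtain ⟨u, hu | ⟨h0, rfl, hcz⟩, huc⟩ := hcQ i
      · exact ⟨u, Or.inr (Or.inr hu), (hΓs i _ _).2 ⟨huc, Or.inl fun hS => hQS i u hu hS.1⟩⟩
      · refine ⟨u, Or.inl rfl, (hΓs i _ _).2 ⟨huc, Or.inl fun hS => ?_⟩⟩
        have := hne _ (hcH i)
        have h2 : c i ∈ ({u, y, z} : Set V) := hS.2
        simp [this, hcz] at h2
    · refine ⟨⟨y, rfl, (hΓn _ _).2 ⟨hey, fun hS => ?_⟩⟩, heyH⟩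
      have := hne _ heyH
      have h2 : ey ∈ ({x, y} : Set V) := hS.2
      simp [this] at h2
    · refine ⟨⟨x, rfl, (hΓn _ _).2 ⟨hex, fun hS => ?_⟩⟩, hexH⟩
      have := hne _ hexH
      have h2 : ex ∈ ({x, y} : Set V) := hS.2
      simp [this] at h2
  · obtain ⟨i, q, hq, hp⟩ := hqx
    exact ⟨Sum.inl i, q, Or.inr (Or.inr hq), hp, (hQD i q hq).2⟩
  · obtain ⟨i, q, hq, hp⟩ := hqy
    exact ⟨Sum.inl i, q, Or.inr (Or.inr hq), hp, (hQD i q hq).2⟩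
  · rintro w hw (rfl | rfl)
    · refine ⟨Sum.inr true, w, rfl, (hΓn _ _).2 ⟨hw.symm, fun hS => ?_⟩⟩
      have h2 := hS.2
      simp [hxz.symm, hyz.symm] at h2
    · refine ⟨Sum.inr false, w, rfl, (hΓn _ _).2 ⟨hw.symm, fun hS => ?_⟩⟩
      have h2 := hS.2
      simp [hxz.symm, hyz.symm] at h2
  · simp [Nat.card_sum, hι]
  · refine ⟨Sum.inr true, fun v hv => Or.inl hv, fun F => ?_⟩
    obtain ⟨v, hvx, hvy, hvF, hxv⟩ := hxo F
    refine ⟨v, hvx, hvy, hvF, x, rfl, (hΓn _ _).2 ⟨hxv, fun hS => ?_⟩⟩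
    have := hne _ ⟨hvx, hvy⟩
    have h2 := hS.2
    simp [this] at h2
  · simp [Finite.card_option, hι]

end CopyFamily

/-- The subgraph of `G` keeping only the edges inside `U`. -/
def restrictTo {V : Type*} (G : SimpleGraph V) (U : Set V) : SimpleGraph V where
  Adj u v := G.Adj u v ∧ u ∈ U ∧ v ∈ U
  symm := ⟨fun _ _ h => ⟨h.1.symm, h.2.2, h.2.1⟩⟩
  loopless := ⟨fun _ h => G.loopless.irrefl _ h.1⟩

theorem restrictTo_mem {V : Type*} {G : SimpleGraph V} {U P : Set V} {a b : V}
    (h : ReachIn (restrictTo G U) P a b) (ha : a ∈ U) : b ∈ U :=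
  h.mem_of_closed ha fun _ _ _ _ _ huv => huv.2.2

namespace CopyFamily

variable {V I : Type*} {G : SimpleGraph V} {part : V → I} {k : ℕ}

/-- Disjoint links between two vertices of the same copy, inside that copy. -/
theorem exists_links_in_copy [Finite V] (h : CopyFamily G part k) {x y : V} (hxy : x ≠ y)
    (hp : part x = part y) {t : ℕ} (ht : t ≤ k) (hadj : G.Adj x y → t + 1 ≤ k) :
    ∃ Q : Fin t → Set V, (∀ i j, i ≠ j → Disjoint (Q i) (Q j)) ∧ ∀ i,
      (∀ v ∈ Q i, part v = part x ∧ v ≠ x ∧ v ≠ y) ∧ ConnOn G (Q i) ∧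
      (∃ u ∈ Q i, G.Adj x u) ∧ ∃ u ∈ Q i, G.Adj y u := by
  classical
  set U : Set V := {v | part v = part x ∧ v ≠ x ∧ v ≠ y} with hU
  obtain ⟨P, hPd, hP⟩ := exists_disjoint_conn_of_separates (restrictTo G U)
    {v | v ∈ U ∧ G.Adj x v} {v | v ∈ U ∧ G.Adj y v} t (by
    intro C hC
    by_contra! hlt
    set C0 : Set V := C ∩ U
    have hC0 : C0.ncard < t := (Set.ncard_le_ncard Set.inter_subset_left (Set.toFinite _)).trans_lt
      hlt
    have hx0 : x ∉ C0 := fun h => h.2.2.1 rfl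
    have hy0 : y ∉ C0 := fun h => h.2.2.2 rfl
    obtain ⟨b, hby, hbx, hxb⟩ : ∃ b, G.Adj b y ∧ b ≠ x ∧
        ReachIn G ({v | part v = part x} \ insert y C0) x b := by
      by_cases hxy' : G.Adj x y
      · have h1 := h.conn (part x) (insert x C0) (by
          have := Set.ncard_insert_le x C0
          have := hadj hxy'
          omega)
        have h2 := h.conn (part x) (insert y C0) (by
          have := Set.ncard_insert_le y C0
          have := hadj hxy'
          omega)
        obtain ⟨v, hv, hvx⟩ : ∃ v, v ∈ {v | part v = part x} ∧ v ∉ insert y (insert x C0) := by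
          by_contra! hcon
          have h3 := Set.ncard_le_ncard (show {v | part v = part x} ⊆ _ from hcon)
            (Set.toFinite _)
          have h4 := Set.ncard_insert_le y (insert x C0)
          have h5 := Set.ncard_insert_le x C0
          have h6 := h.card (part x)
          have h7 := hadj hxy'
          omega
        have hr := h1 y ⟨hp.symm, by simp [hxy.symm, hy0]⟩ v
          ⟨hv, fun h => hvx (Or.inr h)⟩
        obtain ⟨b, hb, hyb⟩ : ∃ b ∈ {v | part v = part x} \ insert x C0, G.Adj y b := by
          by_contra! hcon
          have : v ∈ ({y} : Set V) := by
            refine hr.mem_of_closed rfl ?_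
            rintro u hu w - hw huw
            obtain rfl : u = y := hu
            exact (hcon w hw huw).elim
          exact hvx (Or.inl this)
        refine ⟨b, hyb.symm, fun h => hb.2 (Or.inl h), h2 x ⟨rfl, by simp [hxy, hx0]⟩ b ⟨hb.1, ?_⟩⟩
        rintro (h | h)
        · exact hyb.ne h.symm
        · exact hb.2 (Or.inr h)
      · have h1 := h.conn (part x) C0 (by omega)
        obtain ⟨R, w, hw, -, hR, hR'⟩ := h1.trim (T := {y}) (A := {x}) ⟨rfl, hx0⟩ rfl
          ⟨y, ⟨hp.symm, hy0⟩, rfl⟩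
        obtain rfl : w = y := hw
        rcases hR' with ⟨-, h⟩ | ⟨hc, ⟨x', hx', hxx⟩, u, hu, huw⟩
        · exact (hxy (Set.mem_singleton_iff.1 h).symm).elim
        · obtain rfl : x' = x := hxx
          refine ⟨u, huw, fun h => hxy' (h ▸ huw), (hc x' hx' u hu).mono fun v hv => ?_⟩
          refine ⟨(hR hv).1.1, ?_⟩
          rintro (h | h)
          · exact (hR hv).2 h
          · exact (hR hv).1.2 h
    let R : Set V := {v | v = x ∨ (v ∈ U ∧ v ∉ C ∧ ∃ a, (a ∈ U ∧ G.Adj x a) ∧ a ∉ C ∧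
      ReachIn (restrictTo G U) Cᶜ a v)}
    have hbR : b ∈ R := by
      refine hxb.mem_of_closed (R := R) (Or.inl rfl) ?_
      rintro u hu v hu' ⟨hvp, hv⟩ huv
      by_cases hvx : v = x
      · exact Or.inl hvx
      have hvU : v ∈ U := ⟨hvp, hvx, fun h => hv (Or.inl h)⟩
      have hvC : v ∉ C := fun h => hv (Or.inr ⟨h, hvU⟩)
      refine Or.inr ⟨hvU, hvC, ?_⟩
      rcases hu with rfl | ⟨huU, huC, a, ha, haC, har⟩
      · exact ⟨v, ⟨hvU, huv⟩, hvC, ReachIn.refl _ _ _⟩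
      · exact ⟨a, ha, haC, har.tail ⟨huv, huU, hvU⟩ huC hvC⟩
    obtain ⟨hbU, hbC, a, ha, haC, har⟩ := hbR.resolve_left hbx
    exact hC a ha b ⟨hbU, hby.symm⟩ haC har)
  refine ⟨P, hPd, fun i => ?_⟩
  obtain ⟨hc, ⟨a, haP, haU, hxa⟩, b, hbP, hbU, hyb⟩ := hP i
  exact ⟨fun v hv => show v ∈ U from restrictTo_mem (hc a haP v hv) haU, hc.mono fun u _ v _ huv => huv.1,
    ⟨a, haP, hxa⟩, b, hbP, hyb⟩

/-- Two of the three vertices lie in the same copy, the third one elsewhere. -/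
theorem connectsSet_of_two_in_copy [Finite V] (h : CopyFamily G part k) {x y z : V} (hxy : x ≠ y)
    (hp : part x = part y) (hzx : part z ≠ part x) : ConnectsSet G {x, y, z} (k + 1) := by
  classical
  have h4 := h.four_le
  have hzo : ∃ w, G.Adj z w ∧ part w ≠ part z ∧ part w ≠ part x ∧ part w ≠ part y := by
    obtain ⟨w, h1, h2, h3⟩ := h.exists_out z (part x)
    exact ⟨w, h1, h2, h3, hp ▸ h3⟩
  have hxo : ∀ F, ∃ v, part v ≠ part x ∧ part v ≠ part y ∧ part v ≠ F ∧ G.Adj x v := by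
    intro F
    obtain ⟨w, h1, h2, h3⟩ := h.exists_out x F
    exact ⟨w, h2, hp ▸ h2, h3, h1⟩
  have hout : ∀ {u v w w' : V}, part u = part x → part v = part x → G.Adj u w → G.Adj v w' →
      part w ≠ part x → u ≠ v → w ≠ w' := by
    rintro u v w w' hu hv huw hvw hw huv rfl
    exact huv (h.mate_unique huw hvw (hu ▸ hw) (hu.trans hv.symm))
  have hcx : ∀ {t : ℕ} (Q : Fin t → Set V), (∀ i, ∃ u, u ∈ Q i) →
      (∀ i, ∀ v ∈ Q i, part v = part x ∧ v ≠ x ∧ v ≠ y) → ∃ q c : Fin t → V, (∀ i, q i ∈ Q i) ∧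
        (∀ i, G.Adj (q i) (c i)) ∧ ∀ i, part (c i) ≠ part x := by
    intro t Q hne hQ
    choose q hq using hne
    choose c hc hcp using fun i => h.exists_out (q i) (part x)
    exact ⟨q, c, hq, hc, fun i => (hcp i).2⟩
  obtain ⟨ey, hey, heyp, -⟩ := h.exists_out_ne y z
  rw [← hp] at heyp
  by_cases hadj : G.Adj x y
  · obtain ⟨Q, hQd, hQ⟩ := h.exists_links_in_copy hxy hp (t := k - 1) (by omega) (by omega)
    obtain ⟨q, c, hq, hc, hcp⟩ := hcx Q (fun i => (hQ i).2.2.1.imp fun u hu => hu.1)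
      (fun i => (hQ i).1)
    have hqi : ∀ i j, i ≠ j → q i ≠ q j := fun i j hij hqq =>
      Set.disjoint_left.1 (hQd i j hij) (hq i) (hqq ▸ hq j)
    obtain ⟨e1, he1, he1p, he1z⟩ := h.exists_out_ne x z
    obtain ⟨e2, he2, he2p, he21⟩ := h.exists_out_ne x e1
    refine h.connectsSet_of_links (ι := Option (Fin (k - 1)))
      (by rw [Finite.card_option, Nat.card_fin]; omega) hxy hzx (hp ▸ hzx)
      (fun i => i.elim ∅ Q) ?_ ?_ ?_ ?_ ⟨some ⟨0, by omega⟩, q ⟨0, by omega⟩, hq _, ((hQ _).1 _ (hq _)).1⟩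
      ⟨some ⟨0, by omega⟩, q ⟨0, by omega⟩, hq _, ((hQ _).1 _ (hq _)).1.trans hp⟩
      (fun i => i.elim e1 c) ?_ ?_ ?_ e2 ey he2 hey ⟨he2p, hp ▸ he2p⟩ ⟨heyp, hp ▸ heyp⟩
      (hout rfl hp.symm he2 hey he2p hxy) ?_ ?_ hzo hxo
    · rintro (_ | i) v hv
      · exact hv.elim
      · exact ⟨Or.inl ((hQ i).1 v hv).1, ((hQ i).1 v hv).2⟩
    · rintro (_ | i) (_ | j) hij
      · exact (hij rfl).elim
      · exact Set.empty_disjoint _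
      · exact Set.disjoint_empty _
      · exact hQd i j fun h => hij (h ▸ rfl)
    · rintro (_ | i)
      · exact Or.inl ⟨rfl, hadj⟩
      · exact Or.inr (hQ i).2
    · have hne : ∀ i, Q i ≠ ∅ := fun i h0 => by
        have := hq i
        rw [h0] at this
        exact this
      rintro (_ | i) (_ | j) hi hj
      · rfl
      · exact (hne j hj).elim
      · exact (hne i hi).elim
      · exact (hne i hi).elim
    · rintro (_ | i) (_ | j) hij
      · rfl
      · exact (hout rfl ((hQ j).1 _ (hq j)).1 he1 (hc j) he1p ((hQ j).1 _ (hq j)).2.1.symm hij).elim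
      · exact (hout rfl ((hQ i).1 _ (hq i)).1 he1 (hc i) he1p ((hQ i).1 _ (hq i)).2.1.symm
          hij.symm).elim
      · by_contra hne
        have hne : i ≠ j := fun h => hne (h ▸ rfl)
        exact hout ((hQ i).1 _ (hq i)).1 ((hQ j).1 _ (hq j)).1 (hc i) (hc j) (hcp i)
          (hqi i j hne) hij
    · rintro (_ | i)
      · exact ⟨x, Or.inr ⟨rfl, rfl, he1z⟩, he1⟩
      · exact ⟨q i, Or.inl (hq i), hc i⟩
    · rintro (_ | i)
      · exact ⟨he1p, hp ▸ he1p⟩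
      · exact ⟨hcp i, hp ▸ hcp i⟩
    · rintro (_ | i)
      · exact he21.symm
      · exact hout ((hQ i).1 _ (hq i)).1 rfl (hc i) he2 (hcp i) ((hQ i).1 _ (hq i)).2.1
    · rintro (_ | i)
      · exact hout rfl hp.symm he1 hey he1p hxy
      · exact hout ((hQ i).1 _ (hq i)).1 hp.symm (hc i) hey (hcp i) ((hQ i).1 _ (hq i)).2.2
  · obtain ⟨Q, hQd, hQ⟩ := h.exists_links_in_copy hxy hp (t := k) le_rfl (fun h => (hadj h).elim)
    obtain ⟨q, c, hq, hc, hcp⟩ := hcx Q (fun i => (hQ i).2.2.1.imp fun u hu => hu.1)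
      (fun i => (hQ i).1)
    have hqi : ∀ i j, i ≠ j → q i ≠ q j := fun i j hij hqq =>
      Set.disjoint_left.1 (hQd i j hij) (hq i) (hqq ▸ hq j)
    obtain ⟨e2, he2, he2p, -⟩ := h.exists_out_ne x z
    have hne : ∀ i, Q i ≠ ∅ := fun i h0 => by
      have := hq i
      rw [h0] at this
      exact this
    refine h.connectsSet_of_links (ι := Fin k) (Nat.card_fin k) hxy hzx (hp ▸ hzx) Q
      (fun i v hv => ⟨Or.inl ((hQ i).1 v hv).1, ((hQ i).1 v hv).2⟩) hQd
      (fun i => Or.inr (hQ i).2) (fun i j hi _ => (hne i hi).elim)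
      ⟨⟨0, by omega⟩, q ⟨0, by omega⟩, hq _, ((hQ _).1 _ (hq _)).1⟩
      ⟨⟨0, by omega⟩, q ⟨0, by omega⟩, hq _, ((hQ _).1 _ (hq _)).1.trans hp⟩
      c ?_ (fun i => ⟨q i, Or.inl (hq i), hc i⟩) (fun i => ⟨hcp i, hp ▸ hcp i⟩)
      e2 ey he2 hey ⟨he2p, hp ▸ he2p⟩ ⟨heyp, hp ▸ heyp⟩
      (hout rfl hp.symm he2 hey he2p hxy) ?_ ?_ hzo hxo
    · intro i j hij
      by_contra hne
      exact hout ((hQ i).1 _ (hq i)).1 ((hQ j).1 _ (hq j)).1 (hc i) (hc j) (hcp i)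
        (hqi i j hne) hij
    · intro i
      exact hout ((hQ i).1 _ (hq i)).1 rfl (hc i) he2 (hcp i) ((hQ i).1 _ (hq i)).2.1
    · intro i
      exact hout ((hQ i).1 _ (hq i)).1 hp.symm (hc i) hey (hcp i) ((hQ i).1 _ (hq i)).2.2

end CopyFamily

namespace CopyFamily

variable {V I : Type*} {G : SimpleGraph V} {part : V → I} {k : ℕ}

/-- A fan inside a copy from `x` to prescribed vertices of the same copy. -/
theorem exists_fan_in_copy [Finite V] {ι : Type*} [Finite ι] (h : CopyFamily G part k) {x : V}
    (f : ι → V) (hf : Function.Injective f) (hfp : ∀ i, part (f i) = part x)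
    (hι : Nat.card ι ≤ k ∨ (Nat.card ι ≤ k + 1 ∧ ∃ i, f i = x)) :
    ∃ R : ι → Set V, (∀ i j, i ≠ j → Disjoint (R i) (R j)) ∧ ∀ i,
      (∀ v ∈ R i, part v = part x ∧ v ≠ x) ∧ ConnOn G (R i) ∧
      ((R i = ∅ ∧ f i = x) ∨ ((∃ u ∈ R i, G.Adj x u) ∧ f i ∈ R i)) := by
  obtain ⟨R, hRd, hR⟩ := exists_fan G {v | part v = part x} x (fun i => {f i}) (by
    intro C hC J hCJ
    by_cases hx : ∃ i, f i = x ∧ i ∉ J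
    · obtain ⟨i, hi, hiJ⟩ := hx
      exact ⟨i, hiJ, x, hi.symm, ReachIn.refl _ _ _⟩
    have hCk : C.ncard < k := by
      rcases hι with hι | ⟨hι, i, hi⟩
      · omega
      · have : 0 < J.ncard := by
          rw [Set.ncard_pos (Set.toFinite _)]
          by_contra hJ
          exact hx ⟨i, hi, fun hiJ => hJ ⟨i, hiJ⟩⟩
        omega
    obtain ⟨l, hlJ, hlC⟩ : ∃ l, l ∉ J ∧ f l ∉ C := by
      by_contra! hcon
      have h1 : (Set.univ : Set ι).ncard ≤ (J ∪ f ⁻¹' C).ncard :=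
        Set.ncard_le_ncard (fun l _ => by
          by_cases hl : l ∈ J
          · exact Or.inl hl
          · exact Or.inr (hcon l hl)) (Set.toFinite _)
      have h2 := Set.ncard_union_le J (f ⁻¹' C)
      have h3 : (f ⁻¹' C).ncard ≤ C.ncard :=
        Set.ncard_le_ncard_of_injOn f (fun _ h => h) hf.injOn (Set.toFinite _)
      rw [Set.ncard_univ] at h1
      omega
    exact ⟨l, hlJ, f l, rfl, h.conn (part x) C hCk x ⟨rfl, fun hx => (hC hx).2 rfl⟩ _
      ⟨hfp l, hlC⟩⟩)
  refine ⟨R, hRd, fun i => ⟨fun v hv => (hR i).1 hv, ?_, ?_⟩⟩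
  · rcases (hR i).2 with ⟨h0, -⟩ | ⟨hc, -⟩
    · rw [h0]
      exact ConnOn.empty G
    · exact hc
  · rcases (hR i).2 with ⟨h0, hi⟩ | ⟨-, hu, v, hv, hvi⟩
    · exact Or.inl ⟨h0, (Set.mem_singleton_iff.1 hi).symm⟩
    · obtain rfl : v = f i := hvi
      exact Or.inr ⟨hu, hv⟩

/-- Three different copies, where `x` has no neighbour in the copy of `y` and `z` has an outside
neighbour away from both. -/
theorem connectsSet_of_no_neighbor [Finite V] (h : CopyFamily G part k) {x y z : V}
    (hxy : part x ≠ part y) (hzx : part z ≠ part x) (hzy : part z ≠ part y)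
    (hx : ∀ w, G.Adj x w → part w ≠ part y)
    (hzo : ∃ w, G.Adj z w ∧ part w ≠ part z ∧ part w ≠ part x ∧ part w ≠ part y) :
    ConnectsSet G {x, y, z} (k + 1) := by
  classical
  have h4 := h.four_le
  obtain ⟨ey, hey, heyy, heyx⟩ := h.exists_out y (part x)
  obtain ⟨ex, hex, hexx, hexy⟩ := h.exists_out_ne x ey
  have hle : k ≤ (portSet G part (part x) (part y) \ ({a | part a = part x ∧ G.Adj a y} ∪
      {a | part a = part x ∧ G.Adj a ey})).ncard := by
    have h1 := Set.le_ncard_sdiff ({a | part a = part x ∧ G.Adj a y} ∪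
      {a | part a = part x ∧ G.Adj a ey}) (portSet G part (part x) (part y)) (Set.toFinite _)
    have h2 := Set.ncard_union_le {a | part a = part x ∧ G.Adj a y}
      {a | part a = part x ∧ G.Adj a ey}
    have hone : ∀ b, part b ≠ part x → {a | part a = part x ∧ G.Adj a b}.ncard ≤ 1 := by
      intro b hb
      rw [Set.ncard_le_one (Set.toFinite _)]
      rintro a ⟨ha, hab⟩ a' ⟨ha', hab'⟩
      exact h.mate_unique hab hab' (ha ▸ hb) (ha.trans ha'.symm)
    have h3 := hone y hxy.symm
    have h4 := hone ey heyx
    have h5 := h.edges _ _ hxy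
    omega
  obtain ⟨f, hf, hfm⟩ := exists_subset_of_le_ncard hle
  have hfx : ∀ i, part (f i) = part x := fun i => (hfm i).1.1
  choose m hfadj hmp using fun i => (hfm i).1.2
  have hfey : ∀ i, ¬ G.Adj (f i) ey := fun i hi => (hfm i).2 (Or.inr ⟨hfx i, hi⟩)
  have hmy : ∀ i, m i ≠ y := fun i hi => (hfm i).2 (Or.inl ⟨hfx i, hi ▸ hfadj i⟩)
  have hfnx : ∀ i, f i ≠ x := fun i hi => hx (m i) (hi ▸ hfadj i) (hmp i)
  have hm : Function.Injective m := fun i j hij => hf (h.mate_unique (hfadj i) (hij ▸ hfadj j)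
    (by rw [hmp, hfx]; exact hxy.symm) ((hfx i).trans (hfx j).symm))
  obtain ⟨R, hRd, hR⟩ := h.exists_fan_in_copy f hf hfx (Or.inl (Nat.card_fin k).le)
  obtain ⟨R', hRd', hR'⟩ := h.exists_fan_in_copy m hm hmp (Or.inl (Nat.card_fin k).le)
  have hfR : ∀ i, (∃ u ∈ R i, G.Adj x u) ∧ f i ∈ R i := fun i =>
    (hR i).2.2.resolve_left fun h => hfnx i h.2
  have hmR : ∀ i, (∃ u ∈ R' i, G.Adj y u) ∧ m i ∈ R' i := fun i =>
    (hR' i).2.2.resolve_left fun h => hmy i h.2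
  choose c hc hcf hcy using fun i => h.exists_out (f i) (part y)
  have hcx : ∀ i, part (c i) ≠ part x := fun i => hfx i ▸ hcf i
  have hcne : ∀ {u w i}, part u = part x → G.Adj u w → f i ≠ u → c i ≠ w := by
    rintro u w i hu huw hne rfl
    exact hne (h.mate_unique (hc i) huw (hcf i) ((hfx i).trans hu.symm))
  refine h.connectsSet_of_links (Nat.card_fin k) (fun h => hxy (h ▸ rfl)) hzx hzy
    (fun i => R i ∪ R' i) ?_ ?_ ?_ ?_ ⟨⟨0, by omega⟩, f _, Or.inl (hfR _).2, hfx _⟩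
    ⟨⟨0, by omega⟩, m _, Or.inr (hmR _).2, hmp _⟩ c ?_
    (fun i => ⟨f i, Or.inl (Or.inl (hfR i).2), hc i⟩) (fun i => ⟨hcx i, hcy i⟩) ex ey hex hey
    ⟨hexx, hx ex hex⟩ ⟨heyx, heyy⟩ hexy ?_ ?_ hzo ?_
  · rintro i v (hv | hv)
    · have := (hR i).1 v hv
      exact ⟨Or.inl this.1, this.2, fun h => hxy (this.1.symm.trans (h ▸ rfl))⟩
    · have := (hR' i).1 v hv
      exact ⟨Or.inr this.1, fun h => hxy ((h ▸ rfl : part x = part v).trans this.1), this.2⟩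
  · intro i j hij
    rw [Set.disjoint_left]
    rintro v (hv | hv) (hv' | hv')
    · exact Set.disjoint_left.1 (hRd i j hij) hv hv'
    · exact hxy (((hR i).1 v hv).1.symm.trans ((hR' j).1 v hv').1)
    · exact hxy (((hR j).1 v hv').1.symm.trans ((hR' i).1 v hv).1)
    · exact Set.disjoint_left.1 (hRd' i j hij) hv hv'
  · intro i
    obtain ⟨⟨u, hu, hxu⟩, hfi⟩ := hfR i
    obtain ⟨⟨v, hv, hyv⟩, hmi⟩ := hmR i
    exact Or.inr ⟨(hR i).2.1.union_of_adj (hR' i).2.1 hfi hmi (hfadj i),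
      ⟨u, Or.inl hu, hxu⟩, v, Or.inr hv, hyv⟩
  · intro i j hi _
    have : f i ∈ R i ∪ R' i := Or.inl (hfR i).2
    rw [hi] at this
    exact this.elim
  · intro i j hij
    by_contra hne
    exact hcne (hfx j) (hc j) (fun h => hne (hf h)) hij
  · exact fun i => hcne rfl hex (hfnx i)
  · rintro i rfl
    exact hfey i (hc i)
  · intro F
    obtain ⟨w, h1, h2, h3⟩ := h.exists_out x F
    exact ⟨w, h2, hx w h1, h3, h1⟩

/-- Three different copies, where `x` and `y` have neighbours in each other's copies. -/
theorem connectsSet_of_mutual [Finite V] (h : CopyFamily G part k) {x y z : V}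
    (hxy : part x ≠ part y) (hzx : part z ≠ part x) (hzy : part z ≠ part y)
    (hx : ∃ w, G.Adj x w ∧ part w = part y) (hy : ∃ w, G.Adj y w ∧ part w = part x) :
    ConnectsSet G {x, y, z} (k + 1) := by
  classical
  have h4 := h.four_le
  obtain ⟨y', hy', hyp'⟩ := hy
  obtain ⟨A, hA1, hA2, hAc⟩ : ∃ A, ({x, y'} : Set V) ⊆ A ∧
      A ⊆ portSet G part (part x) (part y) ∧ A.ncard = k + 1 := by
    refine Set.exists_subsuperset_card_eq ?_ ?_ ?_
    · rintro v (rfl | rfl)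
      · exact ⟨rfl, hx⟩
      · exact ⟨hyp', y, hy'.symm, rfl⟩
    · have h2 := Set.ncard_insert_le x {y'}
      have h3 := Set.ncard_singleton y'
      omega
    · have := h.edges _ _ hxy
      omega
  let f : A → V := Subtype.val
  have hf : Function.Injective f := Subtype.val_injective
  have hcard : Nat.card A = k + 1 := by rw [Nat.card_coe_set_eq, hAc]
  have hfx : ∀ i, part (f i) = part x := fun i => (hA2 i.2).1
  choose m hfadj hmp using fun i : A => (hA2 i.2).2
  have hfadj : ∀ i, G.Adj (f i) (m i) := hfadj
  have hm : Function.Injective m := fun i j hij => hf (h.mate_unique (hfadj i) (hij ▸ hfadj j)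
    (by rw [hmp, hfx]; exact hxy.symm) ((hfx i).trans (hfx j).symm))
  let i0 : A := ⟨x, hA1 (by simp)⟩
  let i1 : A := ⟨y', hA1 (by simp)⟩
  have hmi1 : m i1 = y := h.out_unique (hfadj i1) hy'.symm
    (by rw [hmp, hfx]; exact hxy.symm) (hmp i1)
  obtain ⟨R, hRd, hR⟩ := h.exists_fan_in_copy (x := x) f hf hfx (Or.inr ⟨hcard.le, i0, rfl⟩)
  obtain ⟨R', hRd', hR'⟩ := h.exists_fan_in_copy (x := y) m hm hmp (Or.inr ⟨hcard.le, i1, hmi1⟩)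
  have hfR : ∀ i, f i ∈ insert x (R i) := fun i =>
    (hR i).2.2.elim (fun h => Or.inl h.2) fun h => Or.inr h.2
  have hmR : ∀ i, m i ∈ insert y (R' i) := fun i =>
    (hR' i).2.2.elim (fun h => Or.inl h.2) fun h => Or.inr h.2
  have hRc : ∀ i, ConnOn G (insert x (R i)) := by
    intro i
    rcases (hR i).2.2 with ⟨h0, -⟩ | ⟨⟨u, hu, hxu⟩, -⟩
    · rw [h0]
      simpa using ConnOn.singleton G x
    · exact (hR i).2.1.insert_of_adj hu hxu.symm
  have hRc' : ∀ i, ConnOn G (insert y (R' i)) := by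
    intro i
    rcases (hR' i).2.2 with ⟨h0, -⟩ | ⟨⟨u, hu, hxu⟩, -⟩
    · rw [h0]
      simpa using ConnOn.singleton G y
    · exact (hR' i).2.1.insert_of_adj hu hxu.symm
  have hRp : ∀ i, ∀ v ∈ insert x (R i), part v = part x := by
    rintro i v (rfl | hv)
    · rfl
    · exact ((hR i).1 v hv).1
  have hRp' : ∀ i, ∀ v ∈ insert y (R' i), part v = part y := by
    rintro i v (rfl | hv)
    · rfl
    · exact ((hR' i).1 v hv).1
  have hSx : ∀ v, part v = part x → v ∈ ({x, y, z} : Set V) → v = x := by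
    rintro v hv (rfl | rfl | rfl)
    · rfl
    · exact (hxy hv.symm).elim
    · exact (hzx hv).elim
  have hSy : ∀ v, part v = part y → v ∈ ({x, y, z} : Set V) → v = y := by
    rintro v hv (rfl | rfl | rfl)
    · exact (hxy hv).elim
    · rfl
    · exact (hzy hv).elim
  choose c hc hcf hcy using fun i => h.exists_out (f i) (part y)
  have hc : ∀ i, G.Adj (f i) (c i) := hc
  have hcf : ∀ i, part (c i) ≠ part (f i) := hcf
  let Γ : A → SimpleGraph V := fun i =>
    { Adj := fun u v => G.Adj u v ∧
        (f i = x ∨ ¬ (u ∈ ({x, y, z} : Set V) ∧ v ∈ ({x, y, z} : Set V)))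
      symm := ⟨fun u v huv => ⟨huv.1.symm, huv.2.imp_right fun h h' => h ⟨h'.2, h'.1⟩⟩⟩
      loopless := ⟨fun u hu => G.loopless.irrefl u hu.1⟩ }
  have hΓ : ∀ i u v, (Γ i).Adj u v ↔ G.Adj u v ∧
      (f i = x ∨ ¬ (u ∈ ({x, y, z} : Set V) ∧ v ∈ ({x, y, z} : Set V))) := fun _ _ _ => Iff.rfl
  have : Nonempty A := ⟨i0⟩
  have hother : ∀ i : A, ∃ j, j ≠ i := by
    intro i
    have : Nontrivial A := by
      rw [← Finite.one_lt_card_iff_nontrivial]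
      omega
    exact exists_ne i
  refine h.connectsSet_of_pieces hzx hzy id (fun i => insert x (R i) ∪ insert y (R' i)) Γ
    ?_ ?_ ?_ (fun i => ⟨i, rfl, Or.inl (Or.inl rfl)⟩) (fun i => ⟨i, rfl, Or.inr (Or.inl rfl)⟩)
    (fun i u v huv => huv.1) (fun i u v huv hS => ⟨huv, Or.inr hS⟩) ?_ c ?_ ?_ ?_ ?_ ?_
    (Or.inl hcard) hcard.ge
  · rintro i v (hv | hv)
    · exact Or.inl (hRp i v hv)
    · exact Or.inr (hRp' i v hv)
  · rintro i j hij v ⟨(rfl | hv) | (rfl | hv), hv'⟩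
    · simp
    · rcases hv' with (rfl | hv') | (rfl | hv')
      · simp
      · exact (Set.disjoint_left.1 (hRd i j hij) hv hv').elim
      · simp
      · exact (hxy (((hR i).1 v hv).1.symm.trans ((hR' j).1 v hv').1)).elim
    · simp
    · rcases hv' with (rfl | hv') | (rfl | hv')
      · simp
      · exact (hxy (((hR j).1 v hv').1.symm.trans ((hR' i).1 v hv).1)).elim
      · simp
      · exact (Set.disjoint_left.1 (hRd' i j hij) hv hv').elim
  · intro i
    have h1 : ConnOn (Γ i) (insert x (R i)) := (hRc i).mono fun u hu v hv huv =>
      ⟨huv, Or.inr fun hS => huv.ne ((hSx u (hRp i u hu) hS.1).trans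
        (hSx v (hRp i v hv) hS.2).symm)⟩
    have h2 : ConnOn (Γ i) (insert y (R' i)) := (hRc' i).mono fun u hu v hv huv =>
      ⟨huv, Or.inr fun hS => huv.ne ((hSy u (hRp' i u hu) hS.1).trans
        (hSy v (hRp' i v hv) hS.2).symm)⟩
    refine h1.union_of_adj h2 (hfR i) (hmR i) ((hΓ _ _ _).2 ⟨hfadj i, ?_⟩)
    by_cases hi : f i = x
    · exact Or.inl hi
    · exact Or.inr fun hS => hi (hSx _ (hfx i) hS.1)
  · rintro i j hij u hu v hv ⟨h1, h2⟩
    refine hij (hf ?_)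
    rw [h1.2.resolve_right fun h => h ⟨hu, hv⟩, h2.2.resolve_right fun h => h ⟨hu, hv⟩]
  · intro i j hij
    exact hf (h.mate_unique (hc i) (hij ▸ hc j) (hcf i) ((hfx i).trans (hfx j).symm))
  · intro i
    refine ⟨⟨f i, Or.inl (hfR i), hc i, ?_⟩, fun h => hcf i (h.trans (hfx i).symm), hcy i⟩
    by_cases hi : f i = x
    · exact Or.inl hi
    · exact Or.inr fun hS => hi (hSx _ (hfx i) hS.1)
  · obtain ⟨i, hi⟩ := hother i0
    exact ⟨i, f i, Or.inl (hfR i), hfx i, fun h => hi (hf h),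
      fun h => hxy ((hfx i).symm.trans (congrArg part h))⟩
  · obtain ⟨i, hi⟩ := hother i1
    exact ⟨i, m i, Or.inr (hmR i), hmp i, fun h => hxy ((congrArg part h).symm.trans (hmp i)),
      fun h => hi (hm (h.trans hmi1.symm))⟩
  · rintro w hw (rfl | rfl)
    · exact ⟨i0, w, Or.inl (Or.inl rfl), hw.symm, Or.inl rfl⟩
    · exact ⟨i0, w, Or.inr (Or.inl rfl), hw.symm, Or.inl rfl⟩

theorem connectsSet_of_three_copies [Finite V] (h : CopyFamily G part k) {x y z : V}
    (hxy : part x ≠ part y) (hzx : part z ≠ part x) (hzy : part z ≠ part y) :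
    ConnectsSet G {x, y, z} (k + 1) := by
  let has : V → V → Prop := fun u v => ∃ w, G.Adj u w ∧ part w = part v
  have hno : ∀ {u v}, ¬ has u v → ∀ w, G.Adj u w → part w ≠ part v := fun hn w hw hp =>
    hn ⟨w, hw, hp⟩
  have hout : ∀ {u v w}, part u ≠ part v → ¬ (has w u ∧ has w v) →
      ∃ b, G.Adj w b ∧ part b ≠ part w ∧ part b ≠ part u ∧ part b ≠ part v := by
    intro u v w huv hn
    by_contra! hcon
    obtain ⟨b, hb, hbw, hbu⟩ := h.exists_out w (part u)
    obtain ⟨b', hb', hbw', hbv'⟩ := h.exists_out w (part v)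
    have h1 := hcon b hb hbw hbu
    have h2 : part b' = part u := by
      by_contra hne
      exact hbv' (hcon b' hb' hbw' hne)
    exact hn ⟨⟨b', hb', h2⟩, b, hb, h1⟩
  have e1 : ({x, z, y} : Set V) = {x, y, z} := by ext; simp; tauto
  have e2 : ({y, z, x} : Set V) = {x, y, z} := by ext; simp; tauto
  have e3 : ({y, x, z} : Set V) = {x, y, z} := by ext; simp; tauto
  by_cases hm1 : has x y ∧ has y x
  · exact h.connectsSet_of_mutual hxy hzx hzy hm1.1 hm1.2
  by_cases hm2 : has x z ∧ has z x
  · exact e1 ▸ h.connectsSet_of_mutual hzx.symm hxy.symm hzy.symm hm2.1 hm2.2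
  by_cases hm3 : has y z ∧ has z y
  · exact e2 ▸ h.connectsSet_of_mutual hzy.symm hxy hzx.symm hm3.1 hm3.2
  by_cases hz : has z x ∧ has z y
  · have hxz : ¬ has x z := fun h => hm2 ⟨h, hz.1⟩
    have hyz : ¬ has y z := fun h => hm3 ⟨h, hz.2⟩
    exact e1 ▸ h.connectsSet_of_no_neighbor hzx.symm hxy.symm hzy.symm (hno hxz)
      (hout hzx.symm fun h => hyz h.2)
  · by_cases hx : has x y
    · have hy : ¬ has y x := fun h => hm1 ⟨hx, h⟩
      exact e3 ▸ h.connectsSet_of_no_neighbor hxy.symm hzy hzx (hno hy)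
        (hout hxy.symm fun h => hz ⟨h.2, h.1⟩)
    · exact h.connectsSet_of_no_neighbor hxy hzx hzy (hno hx) (hout hxy hz)

end CopyFamily

/-- Connecting trees can be transported along a graph embedding. -/
theorem ConnectsSet.exists_connOn_image {V V' : Type*} {G : SimpleGraph V} {G' : SimpleGraph V'}
    {S : Set V'} {m : ℕ} (h : ConnectsSet G' S m) (f : G' ↪g G) :
    ∃ (Γ : Fin m → SimpleGraph V) (W : Fin m → Set V), (∀ i u v, (Γ i).Adj u v → G.Adj u v) ∧
      (∀ i, ConnOn (Γ i) (W i)) ∧ (∀ i, f '' S ⊆ W i) ∧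
      (∀ i j, i ≠ j → W i ∩ W j ⊆ f '' S) ∧
      (∀ i j, i ≠ j → ∀ a b, ¬ ((Γ i).Adj a b ∧ (Γ j).Adj a b)) ∧
      ∀ i, W i ⊆ Set.range f := by
  obtain ⟨Γ, W, hΓ, hW, hS, hWW, hE⟩ := h.exists_connOn
  refine ⟨fun i => (Γ i).map f.toEmbedding, fun i => f '' W i, ?_, ?_, ?_, ?_, ?_, ?_⟩
  · rintro i u v ⟨-, a, b, hab, rfl, rfl⟩
    exact f.map_rel_iff.2 (hΓ i a b hab)
  · rintro i _ ⟨a, ha, rfl⟩ _ ⟨b, hb, rfl⟩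
    obtain ⟨hr⟩ : Nonempty (ReachIn (Γ i) (W i) a b) := ⟨hW i a ha b hb⟩
    induction hr with
    | refl => exact ReachIn.refl _ _ _
    | tail _ hbc ih =>
      exact (ih hbc.2.1).tail (by
        exact (SimpleGraph.map_adj _ _ _ _).2 ⟨_, _, hbc.1, rfl, rfl⟩) ⟨_, hbc.2.1, rfl⟩ ⟨_, hbc.2.2, rfl⟩
  · exact fun i => Set.image_mono (hS i)
  · rintro i j hij _ ⟨⟨a, ha, rfl⟩, b, hb, hab⟩
    obtain rfl := f.injective hab
    exact ⟨b, hWW i j hij ⟨ha, hb⟩, rfl⟩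
  · rintro i j hij _ _ ⟨⟨-, a, b, hab, rfl, rfl⟩, -, a', b', hab', h1, h2⟩
    obtain rfl := f.injective h1
    obtain rfl := f.injective h2
    exact hE i j hij _ _ ⟨hab, hab'⟩
  · rintro i _ ⟨a, -, rfl⟩
    exact ⟨a, rfl⟩

/-- Three pairs can be separated simultaneously unless they form a triangle. -/
theorem exists_transversal_or_triangle {I : Type*} {a₁ b₁ a₂ b₂ a₃ b₃ : I} (h₁ : a₁ ≠ b₁)
    (h₂ : a₂ ≠ b₂) (h₃ : a₃ ≠ b₃) :
    (∃ J : Set I, (a₁ ∈ J ↔ b₁ ∉ J) ∧ (a₂ ∈ J ↔ b₂ ∉ J) ∧ (a₃ ∈ J ↔ b₃ ∉ J)) ∨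
      ∃ A B C, (a₁ = A ∧ b₁ = B ∨ a₁ = B ∧ b₁ = A) ∧ (a₂ = B ∧ b₂ = C ∨ a₂ = C ∧ b₂ = B) ∧
        (a₃ = A ∧ b₃ = C ∨ a₃ = C ∧ b₃ = A) := by
  by_contra hcon
  obtain ⟨hJ, hT⟩ := not_or.1 hcon
  have key : ∀ c₂ d₂ c₃ d₃, (c₂ = a₂ ∧ d₂ = b₂ ∨ c₂ = b₂ ∧ d₂ = a₂) →
      (c₃ = a₃ ∧ d₃ = b₃ ∨ c₃ = b₃ ∧ d₃ = a₃) →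
      b₁ = c₂ ∨ b₁ = c₃ ∨ d₂ = a₁ ∨ d₂ = c₃ ∨ d₃ = a₁ ∨ d₃ = c₂ := by
    intro c₂ d₂ c₃ d₃ h h'
    by_contra! hc
    refine hJ ⟨{a₁, c₂, c₃}, ?_⟩
    simp only [Set.mem_insert_iff, Set.mem_singleton_iff]
    rcases h with ⟨rfl, rfl⟩ | ⟨rfl, rfl⟩ <;> rcases h' with ⟨rfl, rfl⟩ | ⟨rfl, rfl⟩ <;> grind
  have k1 := key a₂ b₂ a₃ b₃ (by simp) (by simp)
  have k2 := key a₂ b₂ b₃ a₃ (by simp) (by simp)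
  have k3 := key b₂ a₂ a₃ b₃ (by simp) (by simp)
  have k4 := key b₂ a₂ b₃ a₃ (by simp) (by simp)
  have t1 := fun h => hT ⟨a₁, b₁, a₂, h⟩
  have t2 := fun h => hT ⟨a₁, b₁, b₂, h⟩
  have t3 := fun h => hT ⟨b₁, a₁, a₂, h⟩
  have t4 := fun h => hT ⟨b₁, a₁, b₂, h⟩
  clear key hJ hcon hT
  grind (splits := 30)

/-- Two additional disjoint connected sets outside the copy increase the number of trees by two. -/
theorem connectsSet_of_hubs {V : Type*} [Finite V] {G : SimpleGraph V} {S U T₁ T₂ : Set V} {m : ℕ}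
    (Γ : Fin m → SimpleGraph V) (W : Fin m → Set V) (hS0 : S.Nonempty)
    (hΓ : ∀ i u v, (Γ i).Adj u v → G.Adj u v)
    (hW : ∀ i, ConnOn (Γ i) (W i)) (hS : ∀ i, S ⊆ W i)
    (hWW : ∀ i j, i ≠ j → W i ∩ W j ⊆ S)
    (hE : ∀ i j, i ≠ j → ∀ a b, ¬ ((Γ i).Adj a b ∧ (Γ j).Adj a b))
    (hWU : ∀ i, W i ⊆ U) (hSU : S ⊆ U) (hT : Disjoint T₁ T₂)
    (hT₁ : ConnOn G T₁ ∧ Disjoint T₁ U ∧ ∀ s ∈ S, ∃ u ∈ T₁, G.Adj s u)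
    (hT₂ : ConnOn G T₂ ∧ Disjoint T₂ U ∧ ∀ s ∈ S, ∃ u ∈ T₂, G.Adj s u) :
    ConnectsSet G S (m + 2) := by
  let D : SimpleGraph V :=
    { Adj := fun u v => G.Adj u v ∧ ¬ (u ∈ S ∧ v ∈ S)
      symm := ⟨fun u v huv => ⟨huv.1.symm, fun h => huv.2 ⟨h.2, h.1⟩⟩⟩
      loopless := ⟨fun u hu => G.loopless.irrefl u hu.1⟩ }
  have hD : ∀ T, ConnOn G T ∧ Disjoint T U ∧ (∀ s ∈ S, ∃ u ∈ T, G.Adj s u) →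
      ConnOn D (T ∪ S) := by
    rintro T ⟨hc, hd, ha⟩
    have hTS : ∀ u ∈ T, u ∉ S := fun u hu hs => Set.disjoint_left.1 hd hu (hSU hs)
    have hcD : ConnOn D T := hc.mono fun u hu v _ huv => ⟨huv, fun h => hTS u hu h.1⟩
    obtain ⟨s, hs⟩ := hS0
    obtain ⟨r, hr, -⟩ := ha s hs
    refine ConnOn.of_root (r := r) ?_
    rintro a (haT | haS)
    · exact (hcD r hr a haT).mono Set.subset_union_left
    · obtain ⟨u, hu, hau⟩ := ha a haS
      exact ((hcD r hr u hu).mono Set.subset_union_left).tail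
        ⟨hau.symm, fun h => hTS u hu h.1⟩ (Or.inl hu) (Or.inr haS)
  have hWT : ∀ i T, Disjoint T U → W i ∩ (T ∪ S) ⊆ S := by
    rintro i T hd v ⟨h1, h2 | h2⟩
    · exact (Set.disjoint_left.1 hd h2 (hWU i h1)).elim
    · exact h2
  refine connectsSet_of_connOn (Θ := Fin m ⊕ Bool)
    (Sum.elim Γ fun _ => D) (Sum.elim W fun b => bif b then T₁ ∪ S else T₂ ∪ S) hS0 ?_ ?_ ?_ ?_ ?_
    (by simp)
  · rintro (i | b) u v huv
    · exact hΓ i u v huv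
    · exact huv.1
  · rintro (i | _ | _)
    · exact hW i
    · exact hD T₂ hT₂
    · exact hD T₁ hT₁
  · rintro (i | _ | _)
    · exact hS i
    · exact Set.subset_union_right
    · exact Set.subset_union_right
  · rintro (i | _ | _) (j | _ | _) hij
    · exact hWW i j fun h => hij (h ▸ rfl)
    · exact hWT i T₂ hT₂.2.1
    · exact hWT i T₁ hT₁.2.1
    · exact fun v hv => hWT j T₂ hT₂.2.1 hv.symm
    · exact (hij rfl).elim
    · rintro v ⟨h1 | h1, h2 | h2⟩
      · exact (Set.disjoint_left.1 hT h2 h1).elim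
      all_goals assumption
    · exact fun v hv => hWT j T₁ hT₁.2.1 hv.symm
    · rintro v ⟨h1 | h1, h2 | h2⟩
      · exact (Set.disjoint_left.1 hT h1 h2).elim
      all_goals assumption
    · exact (hij rfl).elim
  · rintro (i | b) (j | b') hij u hu v hv ⟨h1, h2⟩
    · exact hE i j (fun h => hij (h ▸ rfl)) u v ⟨h1, h2⟩
    · exact h2.2 ⟨hu, hv⟩
    · exact h1.2 ⟨hu, hv⟩
    · exact h1.2 ⟨hu, hv⟩

namespace CopyFamily

variable {V I : Type*} {G : SimpleGraph V} {part : V → I} {k : ℕ}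

/-- Two disjoint connected sets outside the copy of `x, y, z`, each adjacent to all three, when
the outside neighbours form a triangle of copies. -/
theorem exists_hubs_of_port [Finite V] (h : CopyFamily G part k) {x y z t s za zc xa yc : V}
    (hxy : x ≠ y) (hpy : part y = part x)
    (hxa : G.Adj x xa) (hxt : G.Adj x t) (hys : G.Adj y s) (hyc : G.Adj y yc)
    (hza : G.Adj z za) (hzc : G.Adj z zc)
    (hA : part xa = part za) (hB : part s = part t) (hC : part zc = part yc)
    (hAX : part za ≠ part x) (hBX : part t ≠ part x) (hCX : part yc ≠ part x)
    (hAB : part za ≠ part t) (hAC : part za ≠ part yc) (hBC : part t ≠ part yc)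
    (hZ : 2 ≤ (portSet G part (part t) (part yc) \ portSet G part (part t) (part x)).ncard) :
    ∃ T₁ T₂ : Set V, Disjoint T₁ T₂ ∧
      (ConnOn G T₁ ∧ Disjoint T₁ {v | part v = part x} ∧
        ∀ w ∈ ({x, y, z} : Set V), ∃ u ∈ T₁, G.Adj w u) ∧
      (ConnOn G T₂ ∧ Disjoint T₂ {v | part v = part x} ∧
        ∀ w ∈ ({x, y, z} : Set V), ∃ u ∈ T₂, G.Adj w u) := by
  have h4 := h.four_le
  set Z := portSet G part (part t) (part yc) \ portSet G part (part t) (part x) with hZdef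
  have hst : s ≠ t := by
    rintro rfl
    exact hxy (h.mate_unique hxt hys hBX hpy.symm)
  obtain ⟨P, hPd, hP⟩ := exists_disjoint_conn_of_separates
    (restrictTo G {v | part v = part t}) {s, t} Z 2 (by
    intro C hC
    by_contra! hlt
    obtain ⟨a, ha, haC⟩ := Set.exists_mem_notMem_of_ncard_lt_ncard
      (show C.ncard < ({s, t} : Set V).ncard by rwa [Set.ncard_pair hst])
    obtain ⟨b, hb, hbC⟩ := Set.exists_mem_notMem_of_ncard_lt_ncard (hlt.trans_le hZ)
    have hap : part a = part t := by
      rcases ha with rfl | rfl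
      · exact hB
      · rfl
    refine hC a ha b hb haC ((h.conn (part t) C (by omega) a ⟨hap, haC⟩ b ⟨hb.1.1, hbC⟩).mono'
      (fun v hv => hv.2) fun u hu v hv huv => ⟨huv, hu.1, hv.1⟩))
  have hPB : ∀ i, ∀ v ∈ P i, part v = part t := by
    intro i v hv
    obtain ⟨hc, ⟨a, haP, ha⟩, -⟩ := hP i
    refine restrictTo_mem (U := {v | part v = part t}) (hc a haP v hv) ?_
    rcases ha with rfl | rfl
    · exact hB
    · rfl
  have hPc : ∀ i, ConnOn G (P i) := fun i => (hP i).1.mono fun _ _ _ _ h => h.1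
  obtain ⟨i, j, hij, hsi, htj⟩ : ∃ i j, i ≠ j ∧ s ∈ P i ∧ t ∈ P j := by
    obtain ⟨-, ⟨a, haP, ha⟩, -⟩ := hP 0
    obtain ⟨-, ⟨b, hbP, hb⟩, -⟩ := hP 1
    have h01 := Set.disjoint_left.1 (hPd 0 1 (by simp))
    rcases ha with rfl | rfl <;> rcases hb with rfl | rfl
    · exact (h01 haP hbP).elim
    · exact ⟨0, 1, by simp, haP, hbP⟩
    · exact ⟨1, 0, by simp, hbP, haP⟩
    · exact (h01 haP hbP).elim
  obtain ⟨-, -, b, hbP, ⟨hbp, -⟩, hbX⟩ := hP i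
  obtain ⟨-, -, c, hcP, ⟨hcp, c', hcc, hcC⟩, -⟩ := hP j
  obtain ⟨b', hbb, hbb', hbC⟩ := h.exists_out b (part yc)
  have hb'X : part b' ≠ part x := fun hx => hbX ⟨hbp, b', hbb, hx⟩
  set J : Set I := {l | l ≠ part x ∧ l ≠ part t ∧ l ≠ part yc} with hJ
  have hbJ : part b' ∈ J := ⟨hb'X, hbp ▸ hbb', hbC⟩
  refine ⟨{v | part v ∈ J} ∪ P i, {v | part v ∈ ({part yc} : Set I)} ∪ P j, ?_,
    ⟨(h.conn_union_all J).union_of_adj (hPc i) hbJ hbP hbb.symm, ?_, ?_⟩,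
    ⟨(h.conn_union_all _).union_of_adj (hPc j) hcC hcP hcc.symm, ?_, ?_⟩⟩
  · rw [Set.disjoint_left]
    rintro v (hv | hv) (hv' | hv')
    · exact hv.2.2 hv'
    · exact hv.2.1 (hPB j v hv')
    · exact hBC ((hPB i v hv).symm.trans hv')
    · exact Set.disjoint_left.1 (hPd i j hij) hv hv'
  · rw [Set.disjoint_left]
    rintro v (hv | hv) hv'
    · exact hv.1 hv'
    · exact hBX ((hPB i v hv).symm.trans hv')
  · rintro w (rfl | rfl | rfl)
    · exact ⟨xa, Or.inl (by rw [← hA] at hAX hAB hAC; exact ⟨hAX, hAB, hAC⟩), hxa⟩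
    · exact ⟨s, Or.inr hsi, hys⟩
    · exact ⟨za, Or.inl ⟨hAX, hAB, hAC⟩, hza⟩
  · rw [Set.disjoint_left]
    rintro v (hv | hv) hv'
    · exact hCX (Eq.trans (Eq.symm hv) hv')
    · exact hBX ((hPB j v hv).symm.trans hv')
  · rintro w (rfl | rfl | rfl)
    · exact ⟨t, Or.inr htj, hxt⟩
    · exact ⟨yc, Or.inl rfl, hyc⟩
    · exact ⟨zc, Or.inl hC, hzc⟩

theorem exists_hubs_of_triangle [Finite V] (h : CopyFamily G part k) {x y z t s za zc xa yc : V}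
    (hxy : x ≠ y) (hpy : part y = part x)
    (hxa : G.Adj x xa) (hxt : G.Adj x t) (hys : G.Adj y s) (hyc : G.Adj y yc)
    (hza : G.Adj z za) (hzc : G.Adj z zc)
    (hA : part xa = part za) (hB : part s = part t) (hC : part zc = part yc)
    (hAX : part za ≠ part x) (hBX : part t ≠ part x) (hCX : part yc ≠ part x)
    (hAB : part za ≠ part t) (hAC : part za ≠ part yc) (hBC : part t ≠ part yc) :
    ∃ T₁ T₂ : Set V, Disjoint T₁ T₂ ∧
      (ConnOn G T₁ ∧ Disjoint T₁ {v | part v = part x} ∧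
        ∀ w ∈ ({x, y, z} : Set V), ∃ u ∈ T₁, G.Adj w u) ∧
      (ConnOn G T₂ ∧ Disjoint T₂ {v | part v = part x} ∧
        ∀ w ∈ ({x, y, z} : Set V), ∃ u ∈ T₂, G.Adj w u) := by
  have h4 := h.four_le
  by_cases hZ : 2 ≤ (portSet G part (part t) (part yc) \ portSet G part (part t) (part x)).ncard
  · exact h.exists_hubs_of_port hxy hpy hxa hxt hys hyc hza hzc hA hB hC hAX hBX hCX hAB hAC hBC hZ
  have e : ({y, x, z} : Set V) = {x, y, z} := Set.insert_comm _ _ _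
  have := h.exists_hubs_of_port hxy.symm hpy.symm hyc hys hxt hxa hzc hza hC.symm hB.symm hA.symm
    (by rwa [hC, hpy]) (by rwa [hB, hpy]) (by rwa [hA, hpy]) (by rw [hC, hB]; exact hBC.symm)
    (by rw [hC, hA]; exact hAC.symm) (by rw [hB, hA]; exact hAB.symm) (by
    rw [hB, hA, hpy]
    set X := portSet G part (part t) (part x)
    set C := portSet G part (part t) (part yc)
    set A := portSet G part (part t) (part za)
    have hd : Disjoint (C ∩ X) (A ∩ X) := by
      rw [Set.disjoint_left]
      rintro v ⟨⟨hv, u₁, h1, p1⟩, _, u₂, h2, p2⟩ ⟨⟨_, u₃, h3, p3⟩, _⟩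
      refine h.not_three_outs h1 h2 h3 ?_ ?_ ?_ ?_ ?_ ?_
      · rw [p1, hv]; exact hBC.symm
      · rw [p2, hv]; exact hBX.symm
      · rw [p3, hv]; exact hAB
      · rw [p1, p2]; exact hCX
      · rw [p1, p3]; exact hAC.symm
      · rw [p2, p3]; exact hAX.symm
    have h1 := Set.ncard_union_eq hd (Set.toFinite _) (Set.toFinite _)
    have h2 := Set.ncard_le_ncard (show C ∩ X ∪ A ∩ X ⊆ X from
      Set.union_subset Set.inter_subset_right Set.inter_subset_right) (Set.toFinite _)
    have h3 := Set.ncard_inter_add_ncard_sdiff_eq_ncard C X (Set.toFinite _)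
    have h4' := Set.ncard_inter_add_ncard_sdiff_eq_ncard A X (Set.toFinite _)
    have h5 : X.ncard = C.ncard := h.edges_eq _ _ _ hBX.symm hBC.symm
    have h6 : X.ncard = A.ncard := h.edges_eq _ _ _ hBX.symm hAB
    have h7 : k + 2 ≤ X.ncard := h.edges _ _ hBX
    omega)
  rwa [e, hpy] at this

/-- All three vertices lie in one copy. -/
theorem exists_hubs [Finite V] (h : CopyFamily G part k) {x y z : V}
    (hxy : x ≠ y) (hpy : part y = part x) (hpz : part z = part x) :
    ∃ T₁ T₂ : Set V, Disjoint T₁ T₂ ∧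
      (ConnOn G T₁ ∧ Disjoint T₁ {v | part v = part x} ∧
        ∀ w ∈ ({x, y, z} : Set V), ∃ u ∈ T₁, G.Adj w u) ∧
      (ConnOn G T₂ ∧ Disjoint T₂ {v | part v = part x} ∧
        ∀ w ∈ ({x, y, z} : Set V), ∃ u ∈ T₂, G.Adj w u) := by
  obtain ⟨x₁, x₂, -, hx1, hx2, px1, px2, hx12, -⟩ := h.out x
  obtain ⟨y₁, y₂, -, hy1, hy2, py1, py2, hy12, -⟩ := h.out y
  obtain ⟨z₁, z₂, -, hz1, hz2, pz1, pz2, hz12, -⟩ := h.out z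
  rw [hpy] at py1 py2
  rw [hpz] at pz1 pz2
  rcases exists_transversal_or_triangle hx12 hy12 hz12 with ⟨J, hJx, hJy, hJz⟩ | ⟨A, B, C, hT1, hT2, hT3⟩
  · have hmem : ∀ {w a b : V}, (part a ∈ J ↔ part b ∉ J) → part a ≠ part x → part b ≠ part x →
        G.Adj w a → G.Adj w b → (∃ u ∈ {v | part v ∈ J \ {part x}}, G.Adj w u) ∧
        ∃ u ∈ {v | part v ∈ Jᶜ \ {part x}}, G.Adj w u := by
      intro w a b hJ ha hb hwa hwb
      by_cases haJ : part a ∈ J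
      · exact ⟨⟨a, ⟨haJ, ha⟩, hwa⟩, b, ⟨hJ.1 haJ, hb⟩, hwb⟩
      · exact ⟨⟨b, ⟨not_not.1 fun hbJ => haJ (hJ.2 hbJ), hb⟩, hwb⟩, a, ⟨haJ, ha⟩, hwa⟩
    refine ⟨{v | part v ∈ J \ {part x}}, {v | part v ∈ Jᶜ \ {part x}}, ?_,
      ⟨h.conn_union_all _, ?_, ?_⟩, ⟨h.conn_union_all _, ?_, ?_⟩⟩
    · exact Set.disjoint_left.2 fun v hv hv' => hv'.1 hv.1
    · exact Set.disjoint_left.2 fun v hv hv' => hv.2 hv'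
    · rintro w (rfl | rfl | rfl)
      · exact (hmem hJx px1 px2 hx1 hx2).1
      · exact (hmem hJy py1 py2 hy1 hy2).1
      · exact (hmem hJz pz1 pz2 hz1 hz2).1
    · exact Set.disjoint_left.2 fun v hv hv' => hv.2 hv'
    · rintro w (rfl | rfl | rfl)
      · exact (hmem hJx px1 px2 hx1 hx2).2
      · exact (hmem hJy py1 py2 hy1 hy2).2
      · exact (hmem hJz pz1 pz2 hz1 hz2).2
  · obtain ⟨xa, t, hxa, hxt, qxa, qt, hAB, pX⟩ : ∃ xa t, G.Adj x xa ∧ G.Adj x t ∧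
        part xa = A ∧ part t = B ∧ A ≠ B ∧ A ≠ part x ∧ B ≠ part x := by
      rcases hT1 with ⟨e₁, e₂⟩ | ⟨e₁, e₂⟩
      · exact ⟨x₁, x₂, hx1, hx2, e₁, e₂, e₁ ▸ e₂ ▸ hx12, e₁ ▸ px1, e₂ ▸ px2⟩
      · exact ⟨x₂, x₁, hx2, hx1, e₂, e₁, e₁ ▸ e₂ ▸ hx12.symm, e₂ ▸ px2, e₁ ▸ px1⟩
    obtain ⟨s, yc, hys, hyc, qs, qyc, hBC, pY⟩ : ∃ s yc, G.Adj y s ∧ G.Adj y yc ∧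
        part s = B ∧ part yc = C ∧ B ≠ C ∧ C ≠ part x := by
      rcases hT2 with ⟨e₁, e₂⟩ | ⟨e₁, e₂⟩
      · exact ⟨y₁, y₂, hy1, hy2, e₁, e₂, e₁ ▸ e₂ ▸ hy12, e₂ ▸ py2⟩
      · exact ⟨y₂, y₁, hy2, hy1, e₂, e₁, e₁ ▸ e₂ ▸ hy12.symm, e₁ ▸ py1⟩
    obtain ⟨za, zc, hza, hzc, qza, qzc, hAC⟩ : ∃ za zc, G.Adj z za ∧ G.Adj z zc ∧
        part za = A ∧ part zc = C ∧ A ≠ C := by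
      rcases hT3 with ⟨e₁, e₂⟩ | ⟨e₁, e₂⟩
      · exact ⟨z₁, z₂, hz1, hz2, e₁, e₂, e₁ ▸ e₂ ▸ hz12⟩
      · exact ⟨z₂, z₁, hz2, hz1, e₂, e₁, e₁ ▸ e₂ ▸ hz12.symm⟩
    exact h.exists_hubs_of_triangle hxy hpy hxa hxt hys hyc hza hzc (qxa.trans qza.symm)
      (qs.trans qt.symm) (qzc.trans qyc.symm) (qza ▸ pX.1) (qt ▸ pX.2) (qyc ▸ pY)
      (by rwa [qza, qt]) (by rwa [qza, qyc]) (by rwa [qt, qyc])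

end CopyFamily

section TreeConn

variable {V : Type*} {G : SimpleGraph V} {S : Set V}

theorem ConnOn.exists_adj {P : Set V} {x y : V} (h : ConnOn G P) (hx : x ∈ P) (hy : y ∈ P)
    (hxy : x ≠ y) : ∃ v, G.Adj x v := by
  by_contra! hcon
  refine hxy (Set.mem_singleton_iff.1 ((h x hx y hy).mem_of_closed (R := {x}) rfl ?_)).symm
  rintro u rfl v - - huv
  exact (hcon v huv).elim

theorem ConnectsSet.mono [Finite V] {m t : ℕ} (h : ConnectsSet G S t) (hS : S.Nonempty)
    (hm : m ≤ t) : ConnectsSet G S m := by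
  obtain ⟨Γ, W, hΓ, hW, hSW, hWW, hE⟩ := h.exists_connOn
  exact connectsSet_of_connOn Γ W hS hΓ hW hSW hWW (fun i j hij a _ b _ => hE i j hij a b)
    (by simpa using hm)

theorem ConnectsSet.le_ncard_neighborSet [Finite V] {t : ℕ} {x y : V} (h : ConnectsSet G S t)
    (hx : x ∈ S) (hy : y ∈ S) (hxy : x ≠ y) : t ≤ (G.neighborSet x).ncard := by
  obtain ⟨Γ, W, hΓ, hW, hSW, -, hE⟩ := h.exists_connOn
  choose f hf using fun i => (hW i).exists_adj (hSW i hx) (hSW i hy) hxy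
  have hinj : Function.Injective f := fun i j hij => by
    by_contra hne
    exact hE i j hne x (f i) ⟨hf i, hij ▸ hf j⟩
  have h1 := Set.ncard_le_ncard (show Set.range f ⊆ G.neighborSet x by
    rintro _ ⟨i, rfl⟩
    exact hΓ i _ _ (hf i)) (Set.toFinite _)
  rwa [← Set.image_univ, Set.ncard_image_of_injective _ hinj, Set.ncard_univ, Nat.card_fin] at h1

/-- If there are as many trees as neighbours of `x`, then each neighbour of `x` is the unique
neighbour of `x` in some tree. -/
theorem exists_unique_adj_of_ncard_le [Finite V] {t : ℕ} {x y w : V} {Γ : Fin t → SimpleGraph V}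
    {W : Fin t → Set V} (hΓ : ∀ i u v, (Γ i).Adj u v → G.Adj u v)
    (hW : ∀ i, ConnOn (Γ i) (W i)) (hx : ∀ i, x ∈ W i) (hw : ∀ i, w ∈ W i) (hxw : x ≠ w)
    (hE : ∀ i j, i ≠ j → ∀ a b, ¬ ((Γ i).Adj a b ∧ (Γ j).Adj a b))
    (ht : (G.neighborSet x).ncard ≤ t) (hxy : G.Adj x y) :
    ∃ i, (Γ i).Adj x y ∧ ∀ v, (Γ i).Adj x v → v = y := by
  choose f hf using fun i => (hW i).exists_adj (hx i) (hw i) hxw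
  have hinj : Function.Injective f := fun i j hij => by
    by_contra hne
    exact hE i j hne x (f i) ⟨hf i, hij ▸ hf j⟩
  have hr : Set.range f = G.neighborSet x := by
    refine Set.eq_of_subset_of_ncard_le ?_ ?_ (Set.toFinite _)
    · rintro _ ⟨i, rfl⟩
      exact hΓ i _ _ (hf i)
    · rwa [← Set.image_univ, Set.ncard_image_of_injective _ hinj, Set.ncard_univ, Nat.card_fin]
  obtain ⟨i, rfl⟩ : y ∈ Set.range f := hr ▸ hxy
  refine ⟨i, hf i, fun v hv => ?_⟩
  obtain ⟨j, rfl⟩ : v ∈ Set.range f := hr ▸ hΓ i _ _ hv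
  by_contra hne
  exact hE i j (fun h => hne (h ▸ rfl)) x (f j) ⟨hv, hf j⟩

theorem ConnectsSet.lt_of_adj [Finite V] {t d : ℕ} {x y z : V} (h : ConnectsSet G {x, y, z} t)
    (hxy : G.Adj x y) (hzx : z ≠ x) (hzy : z ≠ y) (hx : (G.neighborSet x).ncard = d)
    (hy : (G.neighborSet y).ncard = d) : t < d := by
  by_contra! hdt
  obtain ⟨Γ, W, hΓ, hW, hSW, -, hE⟩ := h.exists_connOn
  have hxW : ∀ i, x ∈ W i := fun i => hSW i (by simp)
  have hyW : ∀ i, y ∈ W i := fun i => hSW i (by simp)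
  have hzW : ∀ i, z ∈ W i := fun i => hSW i (by simp)
  obtain ⟨i, hi, hi'⟩ := exists_unique_adj_of_ncard_le hΓ hW hxW hyW hxy.ne hE (hx.le.trans hdt) hxy
  obtain ⟨j, hj, hj'⟩ := exists_unique_adj_of_ncard_le hΓ hW hyW hxW hxy.ne' hE (hy.le.trans hdt)
    hxy.symm
  obtain rfl : i = j := by
    by_contra hne
    exact hE i j hne x y ⟨hi, hj.symm⟩
  have : z ∈ ({x, y} : Set V) := (hW i x (hxW i) z (hzW i)).mem_of_closed (by simp) (by
    rintro u (rfl | rfl) v - - huv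
    · exact Or.inr (hi' v huv)
    · exact Or.inl (hj' v huv))
  rcases this with h | h
  · exact hzx h
  · exact hzy h

theorem bddAbove_connectsSet [Finite V] (hS : S.ncard = 3) : BddAbove {r | ConnectsSet G S r} := by
  obtain ⟨x, y, z, hxy, -, -, rfl⟩ := Set.ncard_eq_three.1 hS
  exact ⟨_, fun t ht => ht.le_ncard_neighborSet (x := x) (y := y) (by simp) (by simp) hxy⟩

theorem connectsSet_of_le_kappa3 [Finite V] {m : ℕ} (h : m ≤ kappa3 G) (hm : 0 < m)
    (hS : S.ncard = 3) : ConnectsSet G S m := by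
  have h1 : m ≤ treeConn G S := h.trans (Nat.sInf_le ⟨S, hS, rfl⟩)
  have hne : {r | ConnectsSet G S r}.Nonempty := by
    by_contra hcon
    rw [Set.not_nonempty_iff_eq_empty] at hcon
    rw [treeConn, hcon, csSup_empty, bot_eq_zero] at h1
    omega
  refine ConnectsSet.mono (Nat.sSup_mem hne (bddAbove_connectsSet hS)) ?_ h1
  exact Set.nonempty_of_ncard_ne_zero (by omega)

/-- The value of `kappa3` is pinned by trees for all triples and by one adjacent pair. -/
theorem kappa3_eq_of_forall_connectsSet [Finite V] {m : ℕ} {x y z : V}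
    (h : ∀ S : Set V, S.ncard = 3 → ConnectsSet G S m)
    (hxy : G.Adj x y) (hzx : z ≠ x) (hzy : z ≠ y) (hx : (G.neighborSet x).ncard = m + 1)
    (hy : (G.neighborSet y).ncard = m + 1) : kappa3 G = m := by
  have hS : ({x, y, z} : Set V).ncard = 3 :=
    Set.ncard_eq_three.2 ⟨x, y, z, hxy.ne, hzx.symm, hzy.symm, rfl⟩
  refine le_antisymm (le_trans (Nat.sInf_le ⟨_, hS, rfl⟩) (csSup_le' fun t ht =>
    Nat.lt_succ_iff.1 (ConnectsSet.lt_of_adj ht hxy hzx hzy hx hy))) (le_csInf ⟨_, _, hS, rfl⟩ ?_)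
  rintro _ ⟨S, hS, rfl⟩
  exact le_csSup (bddAbove_connectsSet hS) (h S hS)

end TreeConn

theorem ReachIn.of_reachable {V V' : Type*} {G : SimpleGraph V} {H : SimpleGraph V'} {U : Set V}
    (f : V' → V) (hf : ∀ a b, H.Adj a b → G.Adj (f a) (f b)) (hU : ∀ a, f a ∈ U) {a b : V'}
    (h : H.Reachable a b) : ReachIn G U (f a) (f b) := by
  obtain ⟨w⟩ := h
  induction w with
  | nil => exact ReachIn.refl _ _ _
  | cons hadj _ ih => exact (ReachIn.single (hf _ _ hadj) (hU _) (hU _)).trans ih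

namespace CopyFamily

theorem connectsSet {V V' I : Type*} {G : SimpleGraph V} {part : V → I} {k : ℕ} [Finite V]
    [Finite V'] {G' : SimpleGraph V'} (h : CopyFamily G part k)
    (hiso : ∀ i, Nonempty (G.induce {v | part v = i} ≃g G')) (hG' : kappa3 G' = k - 1)
    {S : Set V} (hS : S.ncard = 3) : ConnectsSet G S (k + 1) := by
  have h4 := h.four_le
  obtain ⟨x, y, z, hxy, hxz, hyz, rfl⟩ := Set.ncard_eq_three.1 hS
  have e1 : ({z, x, y} : Set V) = {x, y, z} := by
    rw [Set.insert_comm z x, Set.pair_comm z y]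
  have e2 : ({x, z, y} : Set V) = {x, y, z} := by rw [Set.pair_comm]
  have e3 : ({y, z, x} : Set V) = {x, y, z} := by
    rw [Set.pair_comm, Set.insert_comm]
  by_cases pxy : part x = part y
  · by_cases pzx : part z = part x
    · obtain ⟨T₁, T₂, hT, hT₁, hT₂⟩ := h.exists_hubs hxy pxy.symm pzx
      obtain ⟨φ⟩ := hiso (part x)
      let f : G' ↪g G := (SimpleGraph.Embedding.induce _).comp φ.symm.toEmbedding
      have hfr : ∀ v, v ∈ Set.range f ↔ part v = part x := by
        intro v
        constructor
        · rintro ⟨a, rfl⟩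
          exact (φ.symm a).2
        · intro hv
          exact ⟨φ ⟨v, hv⟩, by simp [f]⟩
      have hSr : ({x, y, z} : Set V) ⊆ Set.range f := by
        rintro v (rfl | rfl | rfl)
        · exact (hfr _).2 rfl
        · exact (hfr _).2 pxy.symm
        · exact (hfr _).2 pzx
      have himg : f '' (f ⁻¹' {x, y, z}) = {x, y, z} := Set.image_preimage_eq_of_subset hSr
      have hS' : (f ⁻¹' ({x, y, z} : Set V)).ncard = 3 := by
        rw [← hS, ← Set.ncard_image_of_injective _ f.injective, himg]
      obtain ⟨Γ, W, hΓ, hW, hSW, hWW, hE, hWr⟩ :=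
        (connectsSet_of_le_kappa3 hG'.ge (by omega) hS').exists_connOn_image f
      rw [himg] at hSW hWW
      have := connectsSet_of_hubs Γ W (by simp) hΓ hW hSW hWW hE
        (fun i v hv => (hfr v).1 (hWr i hv)) (fun v hv => (hfr v).1 (hSr hv)) hT hT₁ hT₂
      rwa [show k - 1 + 2 = k + 1 by omega] at this
    · exact h.connectsSet_of_two_in_copy hxy pxy pzx
  · by_cases pzx : part z = part x
    · exact e2 ▸ h.connectsSet_of_two_in_copy hxz pzx.symm fun h => pxy h.symm
    · by_cases pzy : part z = part y
      · exact e3 ▸ h.connectsSet_of_two_in_copy hyz pzy.symm pxy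
      · exact h.connectsSet_of_three_copies pxy pzx pzy

theorem kappa3_eq {V V' I : Type*} {G : SimpleGraph V} {part : V → I} {k : ℕ} [Finite V]
    [Finite V'] [Nonempty I] {G' : SimpleGraph V'} (h : CopyFamily G part k)
    (hiso : ∀ i, Nonempty (G.induce {v | part v = i} ≃g G')) (hG' : kappa3 G' = k - 1)
    (hreg : ∀ v, (G.neighborSet v).ncard = k + 2) : kappa3 G = k + 1 := by
  obtain ⟨i⟩ := ‹Nonempty I›
  obtain ⟨x, -⟩ := Set.nonempty_of_ncard_ne_zero (s := {v | part v = i}) (by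
    have := h.card i
    omega)
  obtain ⟨y, hy, z, hz, hyz⟩ := (Set.one_lt_ncard (Set.toFinite (G.neighborSet x))).1 (by
    rw [hreg]
    omega)
  exact kappa3_eq_of_forall_connectsSet (fun S hS => h.connectsSet hiso hG' hS) hy
    (SimpleGraph.Adj.ne' hz) hyz.symm (hreg x) (hreg y)

theorem of_copies {V V' : Type*} [Fintype V] [Fintype V'] {G : SimpleGraph V} {q k M : ℕ}
    {part : V → Fin q} {G' : SimpleGraph V'} (hq : 3 ≤ q) (hk : 4 ≤ k)
    (hiso : ∀ i, Nonempty (G.induce {v | part v = i} ≃g G')) (hconn : IsKConnected k G')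
    (hout : ∀ v, ∃ w₁ w₂ : V, w₁ ≠ w₂ ∧ G.Adj v w₁ ∧ G.Adj v w₂ ∧
      part w₁ ≠ part v ∧ part w₂ ≠ part v ∧ part w₁ ≠ part w₂ ∧
      ∀ w, G.Adj v w → part w ≠ part v → w = w₁ ∨ w = w₂)
    (hE : ∀ i j, i ≠ j →
      {e : V × V | G.Adj e.1 e.2 ∧ part e.1 = i ∧ part e.2 = j}.ncard * (q - 1) = M ∧
      k + 2 ≤ {e : V × V | G.Adj e.1 e.2 ∧ part e.1 = i ∧ part e.2 = j}.ncard) :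
    CopyFamily G part k := by
  have hport : ∀ i j, i ≠ j → (portSet G part i j).ncard =
      {e : V × V | G.Adj e.1 e.2 ∧ part e.1 = i ∧ part e.2 = j}.ncard := by
    intro i j hij
    have himg : portSet G part i j =
        Prod.fst '' {e : V × V | G.Adj e.1 e.2 ∧ part e.1 = i ∧ part e.2 = j} := by
      ext v
      constructor
      · rintro ⟨hv, w, hvw, hw⟩
        exact ⟨(v, w), ⟨hvw, hv, hw⟩, rfl⟩
      · rintro ⟨⟨_, w⟩, ⟨hvw, hv, hw⟩, rfl⟩
        exact ⟨hv, w, hvw, hw⟩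
    rw [himg, Set.InjOn.ncard_image]
    rintro ⟨v, w⟩ ⟨h1, h2, h3⟩ ⟨v', w'⟩ ⟨h1', h2', h3'⟩ (rfl : v = v')
    obtain ⟨w₁, w₂, -, -, -, -, -, hne, hall⟩ := hout v
    have a1 := hall w h1 (by rw [h2, h3]; exact hij.symm)
    have a2 := hall w' h1' (by rw [h2', h3']; exact hij.symm)
    have hww : part w = part w' := h3.trans h3'.symm
    rcases a1 with rfl | rfl <;> rcases a2 with rfl | rfl
    · rfl
    · exact (hne hww).elim
    · exact (hne hww.symm).elim
    · rfl
  refine ⟨hk, ?_, ?_, hout, ?_, ?_⟩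
  · rintro i C hC u ⟨hu, huC⟩ v ⟨hv, hvC⟩
    obtain ⟨φ⟩ := hiso i
    let D : Set V' := {b | (φ.symm b).1 ∈ C}
    have hD : D.ncard < k := (Set.ncard_le_ncard_of_injOn (fun b => (φ.symm b).1)
      (fun b hb => hb) (fun b _ b' _ h => φ.symm.injective (Subtype.ext h))
      (Set.toFinite _)).trans_lt hC
    have hr := (hconn.2 D hD).preconnected ⟨φ ⟨u, hu⟩, by simpa [D] using huC⟩
      ⟨φ ⟨v, hv⟩, by simpa [D] using hvC⟩
    have := ReachIn.of_reachable (G := G) (U := {v | part v = i} \ C)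
      (fun b => (φ.symm b.1).1) (fun a b hab => φ.symm.map_rel_iff.2 hab)
      (fun a => ⟨(φ.symm a.1).2, a.2⟩) hr
    simpa using this
  · intro i
    obtain ⟨φ⟩ := hiso i
    rw [← Nat.card_coe_set_eq, Nat.card_congr φ.toEquiv, Nat.card_eq_fintype_card]
    exact hconn.1
  · intro i j hij
    rw [hport i j hij]
    exact (hE i j hij).2
  · intro i j l hj hl
    rw [hport i j hj.symm, hport i l hl.symm]
    exact Nat.eq_of_mul_eq_mul_right (show 0 < q - 1 by omega)
      ((hE i j hj.symm).1.trans (hE i l hl.symm).1.symm)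

end CopyFamily

/-- let `(G_n)` be a recursive family as in Definition 1: `G₁` is an
`r`-regular, `r`-connected graph on `a` vertices; for `n ≥ 2`, `G_n` is partitioned into
`p_n ≥ 3` copies of `G_{n-1}`, each vertex has exactly two outside neighbours lying in two
distinct other copies, the number of edges between two copies is
`2·a·p₂⋯p_{n-1}/(p_n - 1) ≥ r + 2(n-2) + 2` with `r + 2(n-2) ≥ 4`, and `G_n` is
`(r + 2(n-1))`-regular and `(r + 2(n-1))`-connected.  If `κ₃(G₁) = r - 1` and, for `n ≥ 2`,
any two vertices in different copies have at most one common outside neighbour, then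
`κ₃(G_n) = r + 2n - 3` for all `n ≥ 1`. -/
theorem stmt_5 (r a : ℕ) (hr : 1 ≤ r) (ha : 1 ≤ a)
    (p : ℕ → ℕ) (hp : ∀ n, 2 ≤ n → 3 ≤ p n)
    (V : ℕ → Type*) [∀ n, Fintype (V n)]
    (G : ∀ n, SimpleGraph (V n))
    (part : ∀ n, V n → Fin (p n))
    -- Definition 1 (1)
    (h1reg : ∀ v : V 1, ((G 1).neighborSet v).ncard = r)
    (h1conn : IsKConnected r (G 1))
    (h1card : Fintype.card (V 1) = a)
    -- Definition 1 (2): each part induces a copy of `G_{n-1}`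
    (h2 : ∀ n, 2 ≤ n → ∀ i : Fin (p n),
      Nonempty ((G n).induce {v : V n | part n v = i} ≃g G (n - 1)))
    -- Definition 1 (3): every vertex has exactly two outside neighbours, lying in two
    -- distinct other copies
    (h3 : ∀ n, 2 ≤ n → ∀ v : V n, ∃ w₁ w₂ : V n, w₁ ≠ w₂ ∧
      (G n).Adj v w₁ ∧ (G n).Adj v w₂ ∧
      part n w₁ ≠ part n v ∧ part n w₂ ≠ part n v ∧ part n w₁ ≠ part n w₂ ∧
      (∀ w : V n, (G n).Adj v w → part n w ≠ part n v → w = w₁ ∨ w = w₂))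
    -- Definition 1 (4) and (5): the number of edges between two distinct copies equals
    -- `2·a·p₂⋯p_{n-1}/(p_n - 1)` and is at least `r + 2(n-2) + 2`
    (h45 : ∀ n, 2 ≤ n → ∀ i j : Fin (p n), i ≠ j →
      {e : V n × V n | (G n).Adj e.1 e.2 ∧ part n e.1 = i ∧ part n e.2 = j}.ncard
          * (p n - 1) = 2 * a * ∏ t ∈ Finset.Icc 2 (n - 1), p t ∧
      r + 2 * (n - 2) + 2 ≤
        {e : V n × V n | (G n).Adj e.1 e.2 ∧ part n e.1 = i ∧ part n e.2 = j}.ncard)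
    (h5 : ∀ n, 2 ≤ n → 4 ≤ r + 2 * (n - 2))
    -- Definition 1 (6)
    (h6reg : ∀ n, 1 ≤ n → ∀ v : V n, ((G n).neighborSet v).ncard = r + 2 * (n - 1))
    (h6conn : ∀ n, 1 ≤ n → IsKConnected (r + 2 * (n - 1)) (G n))
    -- hypotheses of the theorem
    (hbase : kappa3 (G 1) = r - 1)
    (hcommon : ∀ n, 2 ≤ n → ∀ u v : V n, part n u ≠ part n v →
      {w : V n | (G n).Adj u w ∧ part n w ≠ part n u ∧
        (G n).Adj v w ∧ part n w ≠ part n v}.ncard ≤ 1) :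
    ∀ n, 1 ≤ n → kappa3 (G n) = r + 2 * n - 3 := by
  intro n hn
  induction n, hn using Nat.le_induction with
  | base => rw [hbase]; omega
  | succ m hm ih =>
    have h2m : 2 ≤ m + 1 := by omega
    have hk : r + 2 * (m + 1 - 2) = r + 2 * (m - 1) := by omega
    have h45' := h45 (m + 1) h2m
    have h5' := h5 (m + 1) h2m
    rw [hk] at h45' h5'
    have hF : CopyFamily (G (m + 1)) (part (m + 1)) (r + 2 * (m - 1)) :=
      CopyFamily.of_copies (hp _ h2m) h5' (h2 _ h2m) (h6conn m hm) (h3 _ h2m) h45'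
    have : Nonempty (Fin (p (m + 1))) := ⟨0, by have := hp _ h2m; omega⟩
    rw [hF.kappa3_eq (h2 _ h2m) (by rw [Nat.add_sub_cancel, ih]; omega) fun v => by
      rw [h6reg _ (by omega)]; omega]
    omega
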